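/- arXiv:2110.04012 — 2 statements merged into one kernel-verified Lean document; each statement's English description precedes it below -/
import Mathlib

section
/- Let 0 < p < ∞, 0 < s < 1 and α, β ≥ 0. Suppose Ω ⊂ ℝ^d is a nonempty, open, κ-plump set (κ ∈ (0,1)) such that one of the following holds: (T) sp+α+β < codim̲_A(∂Ω), Ω is unbounded, and ξ = 0; (T') sp+α+β < codim̲_A(∂Ω), Ω is bounded, and ξ = 1; (F) sp+α+β > codim̄_A(∂Ω), Ω is bounded or ∂Ω is unbounded, and ξ = 0. Then there exist constants c > 0 and R > 0 such that ∫_Ω |u(x)|^p d_Ω(x)^{−sp−α−β} dx ≤ c ∫_Ω ∫_{Ω ∩ B(x, R d_Ω(x))} |u(x)−u(y)|^p |x−y|^{−d−sp} d_Ω(y)^{−β} d_Ω(x)^{−α} dy dx + c ξ ‖u‖_{L^p(Ω)}^p for all measurable functions u : Ω → ℝ for which the left-hand side is finite. -/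
open MeasureTheory Metric Set Filter
open scoped ENNReal NNReal

noncomputable section

/-- Euclidean space `ℝ^d`. -/
abbrev Rd (d : ℕ) := EuclideanSpace ℝ (Fin d)

/-- `d_Ω(x)`: the distance from `x` to the boundary `∂Ω`. -/
def distBd {d : ℕ} (Ω : Set (Rd d)) (x : Rd d) : ℝ := Metric.infDist x (frontier Ω)

/-- The `p`-th power of the weighted Gagliardo seminorm `[f]_{W^{s,p;α,β}(Ω)}^p`, with
power-of-distance-to-the-boundary weights `d_Ω(y)^{-β} d_Ω(x)^{-α}`. -/
def gagP {d : ℕ} (Ω : Set (Rd d)) (s p α β : ℝ) (f : Rd d → ℝ) : ℝ≥0∞ :=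
  ∫⁻ x in Ω, ∫⁻ y in Ω, ENNReal.ofReal
    (|f x - f y| ^ p / dist x y ^ ((d : ℝ) + s * p)
      * distBd Ω y ^ (-β) * distBd Ω x ^ (-α))

/-- The weighted Gagliardo seminorm `[f]_{W^{s,p;α,β}(Ω)}`. -/
def gagSemi {d : ℕ} (Ω : Set (Rd d)) (s p α β : ℝ) (f : Rd d → ℝ) : ℝ≥0∞ :=
  gagP Ω s p α β f ^ (1 / p)

/-- Membership in the weighted fractional Sobolev space `W^{s,p;α,β}(Ω)`. -/
def memW {d : ℕ} (Ω : Set (Rd d)) (s p α β : ℝ) (f : Rd d → ℝ) : Prop :=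
  MemLp f (ENNReal.ofReal p) (volume.restrict Ω) ∧ gagP Ω s p α β f < ⊤

/-- The norm `‖f‖_{L^p(Ω)} + [f]_{W^{s,p;α,β}(Ω)}` (as an extended real). -/
def wNorm {d : ℕ} (Ω : Set (Rd d)) (s p α β : ℝ) (f : Rd d → ℝ) : ℝ≥0∞ :=
  eLpNorm f (ENNReal.ofReal p) (volume.restrict Ω) + gagSemi Ω s p α β f

/-- Membership in `W_0^{s,p;α,β}(Ω)`: the closure of `C_c^∞(Ω) ∩ W^{s,p;α,β}(Ω)` in
`W^{s,p;α,β}(Ω)`. -/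
def memW0 {d : ℕ} (Ω : Set (Rd d)) (s p α β : ℝ) (f : Rd d → ℝ) : Prop :=
  memW Ω s p α β f ∧ ∀ ε : ℝ, 0 < ε → ∃ φ : Rd d → ℝ,
    ContDiff ℝ (⊤ : ℕ∞) φ ∧ HasCompactSupport φ ∧ tsupport φ ⊆ Ω ∧ memW Ω s p α β φ ∧
    wNorm Ω s p α β (fun x => f x - φ x) < ENNReal.ofReal ε

/-- The defining set for the lower Assouad codimension: admissible exponents `q`. -/
def lowerCodimSet {d : ℕ} (E : Set (Rd d)) : Set ℝ :=
  {q : ℝ | 0 ≤ q ∧ ∃ C : ℝ, 1 ≤ C ∧ ∀ x ∈ E, ∀ r R : ℝ, 0 < r → r < R →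
    ENNReal.ofReal R < EMetric.diam E →
    volume (Metric.cthickening r E ∩ Metric.ball x R)
      ≤ ENNReal.ofReal (C * (r / R) ^ q) * volume (Metric.ball x R)}

/-- The lower Assouad codimension. -/
def lowerCodimA {d : ℕ} (E : Set (Rd d)) : ℝ := sSup (lowerCodimSet E)

/-- The upper Assouad codimension. -/
def upperCodimA {d : ℕ} (E : Set (Rd d)) : ℝ :=
  sInf {q : ℝ | 0 ≤ q ∧ ∃ c : ℝ, 0 < c ∧ ∀ x ∈ E, ∀ r R : ℝ, 0 < r → r < R →
    ENNReal.ofReal R < EMetric.diam E →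
    ENNReal.ofReal (c * (r / R) ^ q) * volume (Metric.ball x R)
      ≤ volume (Metric.cthickening r E ∩ Metric.ball x R)}

/-- The upper Minkowski dimension. -/
def upperMinkDim {d : ℕ} (E : Set (Rd d)) : ℝ :=
  sInf {t : ℝ | 0 ≤ t ∧
    Filter.limsup (fun r : ℝ =>
        volume (Metric.cthickening r E) * ENNReal.ofReal (r ^ (t - (d : ℝ))))
      (nhdsWithin 0 (Set.Ioi 0)) = 0}

/-- Uniform domain: any two points are joined by a `1`-Lipschitz (arc-length parameterized)
curve of length `≤ C|x-y|` staying quantitatively away from the boundary. -/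
def IsUniformDomain {d : ℕ} (Ω : Set (Rd d)) : Prop :=
  ∃ C : ℝ, 1 ≤ C ∧ ∀ x ∈ Ω, ∀ y ∈ Ω, ∃ (l : ℝ) (γ : ℝ → Rd d),
    0 ≤ l ∧ l ≤ C * dist x y ∧ γ 0 = x ∧ γ l = y ∧
    (∀ t ∈ Set.Icc 0 l, γ t ∈ Ω) ∧
    LipschitzOnWith 1 γ (Set.Icc 0 l) ∧
    ∀ t ∈ Set.Icc 0 l,
      min (dist (γ t) x) (dist (γ t) y) / C ≤ Metric.infDist (γ t) (frontier Ω)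

/-- `κ`-plumpness. -/
def IsPlump {d : ℕ} (κ : ℝ) (E : Set (Rd d)) : Prop :=
  ∀ r : ℝ, 0 < r → ENNReal.ofReal r < EMetric.diam E →
    ∀ x ∈ closure E, ∃ z ∈ Metric.closedBall x r, Metric.ball z (κ * r) ⊆ E

/-- `σ`-homogeneity: `|V(E,x,λ,r)| ≤ L r^d λ^σ` where
`V(E,x,λ,r) = {y : dist(y,E) ≤ r, |x-y| ≤ λ r}`. -/
def IsHomog {d : ℕ} (σ : ℝ) (E : Set (Rd d)) : Prop :=
  ∃ L : ℝ, 0 < L ∧ ∀ x ∈ E, ∀ lam r : ℝ, 1 ≤ lam → 0 < r →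
    volume (Metric.cthickening r E ∩ Metric.closedBall x (lam * r))
      ≤ ENNReal.ofReal (L * r ^ (d : ℝ) * lam ^ σ)

/-- The axis-parallel cube with corner `a` and side length `l`. -/
def cube {d : ℕ} (a : Rd d) (l : ℝ) : Set (Rd d) :=
  {y | ∀ i, y i ∈ Set.Icc (a i) (a i + l)}

/-- Muckenhoupt `A₁` class: `|Q|⁻¹ ∫_Q w ≤ A inf_Q w` for all cubes `Q`. -/
def IsA1 {d : ℕ} (w : Rd d → ℝ) : Prop :=
  (∀ x, 0 < w x) ∧ ∃ A : ℝ, 0 < A ∧ ∀ (a : Rd d) (l : ℝ), 0 < l →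
    ∫⁻ x in cube a l, ENNReal.ofReal (w x)
      ≤ ENNReal.ofReal (A * l ^ (d : ℝ)) * ⨅ y ∈ cube a l, ENNReal.ofReal (w y)

/-- The `p`-th power of the Gagliardo seminorm with general weights `w(x) v(y)`. -/
def gagPW {d : ℕ} (Ω : Set (Rd d)) (s p : ℝ) (w v f : Rd d → ℝ) : ℝ≥0∞ :=
  ∫⁻ x in Ω, ∫⁻ y in Ω, ENNReal.ofReal
    (|f x - f y| ^ p / dist x y ^ ((d : ℝ) + s * p) * w x * v y)

/-- Membership in `W^{s,p;w,v}(Ω)` for general weights. -/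
def memWgen {d : ℕ} (Ω : Set (Rd d)) (s p : ℝ) (w v f : Rd d → ℝ) : Prop :=
  MemLp f (ENNReal.ofReal p) (volume.restrict Ω) ∧ gagPW Ω s p w v f < ⊤

/-- The norm of `W^{s,p;w,v}(Ω)` (as an extended real). -/
def wNormGen {d : ℕ} (Ω : Set (Rd d)) (s p : ℝ) (w v f : Rd d → ℝ) : ℝ≥0∞ :=
  eLpNorm f (ENNReal.ofReal p) (volume.restrict Ω) + gagPW Ω s p w v f ^ (1 / p)

/-- Membership in `W_0^{s,p;w,v}(Ω)`. -/
def memW0gen {d : ℕ} (Ω : Set (Rd d)) (s p : ℝ) (w v f : Rd d → ℝ) : Prop :=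
  memWgen Ω s p w v f ∧ ∀ ε : ℝ, 0 < ε → ∃ φ : Rd d → ℝ,
    ContDiff ℝ (⊤ : ℕ∞) φ ∧ HasCompactSupport φ ∧ tsupport φ ⊆ Ω ∧ memWgen Ω s p w v φ ∧
    wNormGen Ω s p w v (fun x => f x - φ x) < ENNReal.ofReal ε

/-- Membership in `W_c^{s,p;w,v}(Ω)`: the closure of compactly supported measurable
functions. -/
def memWcgen {d : ℕ} (Ω : Set (Rd d)) (s p : ℝ) (w v f : Rd d → ℝ) : Prop :=
  memWgen Ω s p w v f ∧ ∀ ε : ℝ, 0 < ε → ∃ g : Rd d → ℝ,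
    Measurable g ∧ HasCompactSupport g ∧ tsupport g ⊆ Ω ∧ memWgen Ω s p w v g ∧
    wNormGen Ω s p w v (fun x => f x - g x) < ENNReal.ofReal ε

end

/-- The points `y ∈ Ω` whose distance to `∂Ω` is comparable to that of `x`, with ratio in
`(lo, hi)`, and which lie at distance less than `R d_Ω(x)` from `x`. -/
def comparableSet {d : ℕ} (Ω : Set (Rd d)) (lo hi R : ℝ) (x : Rd d) : Set (Rd d) :=
  {y | y ∈ Ω ∧ lo * distBd Ω x < distBd Ω y ∧ distBd Ω y < hi * distBd Ω x ∧
    dist x y < R * distBd Ω x}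

theorem continuous_distBd {d : ℕ} (Ω : Set (Rd d)) : Continuous (distBd Ω) :=
  Metric.continuous_infDist_pt _

theorem measurableSet_comparable {d : ℕ} {Ω : Set (Rd d)} (hopen : IsOpen Ω) (lo hi R : ℝ) :
    MeasurableSet {z : Rd d × Rd d | z.2 ∈ comparableSet Ω lo hi R z.1} := by
  have h₁ : Continuous fun z : Rd d × Rd d => distBd Ω z.1 :=
    (continuous_distBd Ω).comp continuous_fst
  have h₂ : Continuous fun z : Rd d × Rd d => distBd Ω z.2 :=
    (continuous_distBd Ω).comp continuous_snd
  refine IsOpen.measurableSet ?_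
  refine (hopen.preimage continuous_snd).inter
    ((isOpen_lt (continuous_const.mul h₁) h₂).inter
      ((isOpen_lt h₂ (continuous_const.mul h₁)).inter
        (isOpen_lt continuous_dist (continuous_const.mul h₁))))

theorem distBd_pos {d : ℕ} {Ω : Set (Rd d)} (hopen : IsOpen Ω) (hE : (frontier Ω).Nonempty)
    {x : Rd d} (hx : x ∈ Ω) : 0 < distBd Ω x := by
  refine (isClosed_frontier.notMem_iff_infDist_pos hE).1 fun h => ?_
  rw [hopen.frontier_eq] at h
  exact h.2 hx

theorem abs_rpow_le_two_rpow_mul (a b : ℝ) {p : ℝ} (hp : 0 < p) :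
    |a| ^ p ≤ 2 ^ p * (|a - b| ^ p + |b| ^ p) := by
  have h : |a| ≤ |a - b| + |b| := by simpa using abs_add_le (a - b) b
  have ha := Real.rpow_nonneg (abs_nonneg (a - b)) p
  have hb := Real.rpow_nonneg (abs_nonneg b) p
  have h2 : (0 : ℝ) < 2 ^ p := by positivity
  rcases le_total |a - b| |b| with hle | hle
  · calc |a| ^ p ≤ (2 * |b|) ^ p := Real.rpow_le_rpow (abs_nonneg a) (by linarith) hp.le
      _ = 2 ^ p * |b| ^ p := Real.mul_rpow (by norm_num) (abs_nonneg b)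
      _ ≤ _ := by gcongr; linarith
  · calc |a| ^ p ≤ (2 * |a - b|) ^ p := Real.rpow_le_rpow (abs_nonneg a) (by linarith) hp.le
      _ = 2 ^ p * |a - b| ^ p := Real.mul_rpow (by norm_num) (abs_nonneg _)
      _ ≤ _ := by gcongr; linarith

/-- On a comparable pair the weight `d_Ω(x)^{-γ-d}` is dominated by the Gagliardo kernel. -/
theorem weight_le_kernel {D E t a s p α β R hi : ℝ} (n : ℕ) (hD : 0 < D) (hE : 0 < E)
    (ht : 0 ≤ t) (ha : 0 ≤ a) (hat : t = 0 → a = 0) (htR : t < R * D) (hEh : E < hi * D)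
    (hhi : 0 < hi) (hR : 0 < R) (hs : 0 < s) (hp : 0 < p) (hβ : 0 ≤ β) :
    D ^ (-(s * p + α + β) - n) * a ≤
      R ^ ((n : ℝ) + s * p) * hi ^ β *
        (a / t ^ ((n : ℝ) + s * p) * E ^ (-β) * D ^ (-α)) := by
  rcases ht.eq_or_lt with h | h
  · simp [hat h.symm]
  have hsp : 0 < s * p := mul_pos hs hp
  have e : D ^ (-(s * p + α + β) - n) = D ^ (-((n : ℝ) + s * p)) * D ^ (-β) * D ^ (-α) := by
    rw [← Real.rpow_add hD, ← Real.rpow_add hD]; congr 1; ring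
  have h1 : D ^ (-((n : ℝ) + s * p)) ≤ R ^ ((n : ℝ) + s * p) * (t ^ ((n : ℝ) + s * p))⁻¹ := by
    rw [Real.rpow_neg hD.le, ← div_eq_mul_inv, le_div_iff₀ (by positivity),
      inv_mul_le_iff₀ (by positivity), ← Real.mul_rpow hD.le hR.le]
    exact Real.rpow_le_rpow ht (by linarith) (by positivity)
  have h2 : D ^ (-β) ≤ hi ^ β * E ^ (-β) := by
    rw [Real.rpow_neg hD.le, Real.rpow_neg hE.le, ← div_eq_mul_inv, le_div_iff₀ (by positivity),
      inv_mul_le_iff₀ (by positivity), ← Real.mul_rpow hD.le hhi.le]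
    exact Real.rpow_le_rpow hE.le (by linarith) hβ
  rw [e]
  calc D ^ (-((n : ℝ) + s * p)) * D ^ (-β) * D ^ (-α) * a
      ≤ (R ^ ((n : ℝ) + s * p) * (t ^ ((n : ℝ) + s * p))⁻¹) * (hi ^ β * E ^ (-β)) *
        D ^ (-α) * a := by gcongr
    _ = _ := by ring

theorem le_two_mul_of_le_half_add {a b : ℝ≥0∞} (ha : a ≠ ⊤) (hab : a ≤ 2⁻¹ * a + b) :
    a ≤ 2 * b := by
  have h1 : 2⁻¹ * a + 2⁻¹ * a = a := by rw [← add_mul, ENNReal.inv_two_add_inv_two, one_mul]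
  have h2 : 2⁻¹ * a ≤ b := by
    have hfin : 2⁻¹ * a ≠ ⊤ := ENNReal.mul_ne_top (by simp) ha
    refine (ENNReal.add_le_add_iff_left hfin).1 ?_
    rwa [h1]
  calc a = 2 * (2⁻¹ * a) := by
        rw [← mul_assoc, ENNReal.mul_inv_cancel (by simp) (by simp), one_mul]
    _ ≤ _ := by gcongr

set_option maxHeartbeats 400000 in
theorem hardy_of_comparableSet {d : ℕ} {Ω G : Set (Rd d)} (hopen : IsOpen Ω)
    (hE : (frontier Ω).Nonempty) (hG : MeasurableSet G) (hGΩ : G ⊆ Ω)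
    {s p α β lo hi R m V : ℝ} (hs : 0 < s) (hp : 0 < p) (hα : 0 ≤ α) (hβ : 0 ≤ β)
    (hhi : 0 < hi) (hR : 0 < R) (hm : 0 < m)
    (hlower : ∀ x ∈ G,
      ENNReal.ofReal (m * distBd Ω x ^ d) ≤ volume (comparableSet Ω lo hi R x))
    (hupper : ∀ y ∈ Ω,
      volume {x ∈ Ω | y ∈ comparableSet Ω lo hi R x} ≤ ENNReal.ofReal (V * distBd Ω y ^ d))
    (hsmall : 2 ^ p / m * (hi ^ (s * p + α + β + d) * V) ≤ 1 / 2) :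
    ∃ c : ℝ, 0 < c ∧ ∀ u : Rd d → ℝ, Measurable u →
      (∫⁻ x in Ω, ENNReal.ofReal (|u x| ^ p * distBd Ω x ^ (-(s * p + α + β)))) < ⊤ →
      (∫⁻ x in Ω, ENNReal.ofReal (|u x| ^ p * distBd Ω x ^ (-(s * p + α + β))))
        ≤ ENNReal.ofReal c *
            (∫⁻ x in Ω, ∫⁻ y in Ω ∩ Metric.ball x (R * distBd Ω x), ENNReal.ofReal
              (|u x - u y| ^ p / dist x y ^ ((d : ℝ) + s * p)
                * distBd Ω y ^ (-β) * distBd Ω x ^ (-α)))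
          + 2 * ∫⁻ x in Ω \ G,
              ENNReal.ofReal (|u x| ^ p * distBd Ω x ^ (-(s * p + α + β))) := by
  set γ := s * p + α + β with hγ
  set D := distBd Ω with hD
  set A := comparableSet Ω lo hi R with hA
  have hDc : Continuous D := continuous_distBd Ω
  have hDm : Measurable D := hDc.measurable
  have hDpos : ∀ x ∈ Ω, 0 < D x := fun x hx => distBd_pos hopen hE hx
  have hAm := measurableSet_comparable hopen lo hi R
  have hAxm : ∀ x, MeasurableSet (A x) := fun x => measurable_prodMk_left hAm
  have hγ0 : 0 < γ := by positivity
  have hexp : -γ - (d : ℝ) ≤ 0 := by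
    have : (0 : ℝ) ≤ d := by positivity
    linarith
  set c₁ := 2 ^ p / m * (R ^ ((d : ℝ) + s * p) * hi ^ β) with hc₁
  have hc₁pos : 0 < c₁ := by positivity
  refine ⟨2 * c₁, by positivity, fun u hu hfin => ?_⟩
  set f : Rd d → ℝ≥0∞ := fun x => ENNReal.ofReal (|u x| ^ p * D x ^ (-γ)) with hf
  set J : Rd d → ℝ≥0∞ := fun x => ∫⁻ y in Ω ∩ Metric.ball x (R * D x), ENNReal.ofReal
    (|u x - u y| ^ p / dist x y ^ ((d : ℝ) + s * p) * D y ^ (-β) * D x ^ (-α)) with hJ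
  set g : Rd d → Rd d → ℝ≥0∞ := fun x y =>
    ENNReal.ofReal (2 ^ p / m * (D x ^ (-γ - d) * |u y| ^ p)) with hg
  set S : Set (Rd d × Rd d) := {z | z.1 ∈ G ∧ z.2 ∈ A z.1} with hS
  have hSm : MeasurableSet S := (measurable_fst hG).inter hAm
  have hgm : Measurable (Function.uncurry g) := by
    refine Measurable.ennreal_ofReal ?_
    exact measurable_const.mul (((hDm.comp measurable_fst).pow_const _).mul
      ((_root_.continuous_abs.measurable.comp (hu.comp measurable_snd)).pow_const _))
  set h : Rd d → Rd d → ℝ≥0∞ := fun x y => S.indicator (Function.uncurry g) (x, y) with hh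
  have hhm : Measurable (Function.uncurry h) := hgm.indicator hSm
  have hpoint : ∀ x ∈ G, f x ≤ ENNReal.ofReal c₁ * J x + ∫⁻ y, h x y := by
    intro x hxG
    have hDx := hDpos x (hGΩ hxG)
    have e1 : ∫⁻ y, h x y = ∫⁻ y in A x, g x y := by
      rw [← lintegral_indicator (hAxm x)]
      refine lintegral_congr fun y => ?_
      by_cases hy : y ∈ A x
      · have hz : (x, y) ∈ S := ⟨hxG, hy⟩
        rw [indicator_of_mem hy]
        exact indicator_of_mem hz _
      · have hz : (x, y) ∉ S := fun h => hy h.2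
        rw [indicator_of_notMem hy]
        exact indicator_of_notMem hz _
    have e2 : f x ≤ ∫⁻ _ in A x, ENNReal.ofReal (|u x| ^ p * D x ^ (-γ) / (m * D x ^ d)) := by
      rw [setLIntegral_const]
      calc f x = ENNReal.ofReal (|u x| ^ p * D x ^ (-γ) / (m * D x ^ d)) *
            ENNReal.ofReal (m * D x ^ d) := by
            rw [← ENNReal.ofReal_mul (by positivity), div_mul_cancel₀ _ (by positivity)]
        _ ≤ _ := by gcongr; exact hlower x hxG
    have e3 : ∫⁻ _ in A x, ENNReal.ofReal (|u x| ^ p * D x ^ (-γ) / (m * D x ^ d)) ≤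
        ∫⁻ y in A x, (ENNReal.ofReal (2 ^ p / m * (D x ^ (-γ - d) * |u x - u y| ^ p)) + g x y) := by
      refine lintegral_mono fun y => ?_
      rw [hg, ← ENNReal.ofReal_add (by positivity) (by positivity)]
      refine ENNReal.ofReal_le_ofReal ?_
      have h3 : D x ^ (-γ - d) = D x ^ (-γ) / D x ^ d := by
        rw [Real.rpow_sub hDx, Real.rpow_natCast]
      rw [h3]
      have := abs_rpow_le_two_rpow_mul (u x) (u y) hp
      calc |u x| ^ p * D x ^ (-γ) / (m * D x ^ d)
          ≤ (2 ^ p * (|u x - u y| ^ p + |u y| ^ p)) * D x ^ (-γ) / (m * D x ^ d) := by gcongr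
        _ = _ := by field_simp
    have hgx : Measurable (g x) := hgm.of_uncurry_left
    refine (e2.trans e3).trans ?_
    rw [lintegral_add_right _ hgx, e1]
    gcongr
    rw [hJ, ← lintegral_const_mul' _ _ ENNReal.ofReal_ne_top]
    calc ∫⁻ y in A x, ENNReal.ofReal (2 ^ p / m * (D x ^ (-γ - d) * |u x - u y| ^ p))
        ≤ ∫⁻ y in A x, ENNReal.ofReal c₁ * ENNReal.ofReal
          (|u x - u y| ^ p / dist x y ^ ((d : ℝ) + s * p) * D y ^ (-β) * D x ^ (-α)) := by
          refine setLIntegral_mono' (hAxm x) fun y hy => ?_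
          rw [← ENNReal.ofReal_mul hc₁pos.le]
          refine ENNReal.ofReal_le_ofReal ?_
          rw [hc₁, mul_assoc]
          refine mul_le_mul_of_nonneg_left ?_ (by positivity)
          refine weight_le_kernel d hDx (hDpos y hy.1) dist_nonneg (by positivity) ?_ hy.2.2.2
            hy.2.2.1 hhi hR hs hp hβ
          intro h0
          rw [dist_eq_zero.1 h0]
          simp [Real.zero_rpow hp.ne']
      _ ≤ _ := by
          refine lintegral_mono_set fun y hy => ⟨hy.1, ?_⟩
          rw [Metric.mem_ball']
          exact hy.2.2.2
  have hswap : ∫⁻ x, ∫⁻ y, h x y ≤ 2⁻¹ * ∫⁻ y in Ω, f y := by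
    rw [lintegral_lintegral_swap hhm.aemeasurable, ← lintegral_const_mul' _ _ (by simp),
      ← lintegral_indicator hopen.measurableSet]
    refine lintegral_mono fun y => ?_
    by_cases hy : y ∈ Ω
    swap
    · have : ∀ x, h x y = 0 := fun x => by
        simp only [hh]
        exact indicator_of_notMem (fun hz => hy hz.2.1) _
      simp [this]
    rw [indicator_of_mem hy]
    have hDy := hDpos y hy
    set T : Set (Rd d) := {x ∈ Ω | y ∈ A x} with hT
    have hTm : MeasurableSet T := hopen.measurableSet.inter (measurable_prodMk_right hAm)
    calc ∫⁻ x, h x y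
        ≤ ∫⁻ x, T.indicator
          (fun _ => ENNReal.ofReal (2 ^ p / m * ((D y / hi) ^ (-γ - d) * |u y| ^ p))) x := by
          refine lintegral_mono fun x => ?_
          by_cases hz : (x, y) ∈ S
          · have hxT : x ∈ T := ⟨hGΩ hz.1, hz.2⟩
            rw [indicator_of_mem hxT]
            simp only [hh]
            rw [indicator_of_mem hz]
            refine ENNReal.ofReal_le_ofReal ?_
            refine mul_le_mul_of_nonneg_left (mul_le_mul_of_nonneg_right ?_ (by positivity))
              (by positivity)
            refine Real.rpow_le_rpow_of_nonpos (by positivity) ?_ hexp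
            rw [div_le_iff₀ hhi, mul_comm]
            exact hz.2.2.2.1.le
          · simp only [hh]
            rw [indicator_of_notMem hz]
            exact zero_le
      _ = ENNReal.ofReal (2 ^ p / m * ((D y / hi) ^ (-γ - d) * |u y| ^ p)) * volume T := by
          rw [lintegral_indicator hTm, setLIntegral_const]
      _ ≤ ENNReal.ofReal (2 ^ p / m * ((D y / hi) ^ (-γ - d) * |u y| ^ p)) *
          ENNReal.ofReal (V * D y ^ d) := by gcongr; exact hupper y hy
      _ = ENNReal.ofReal (2 ^ p / m * (hi ^ (γ + d) * V) * (|u y| ^ p * D y ^ (-γ))) := by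
          rw [← ENNReal.ofReal_mul (by positivity)]
          congr 1
          have h4 : (D y / hi) ^ (-γ - d) = hi ^ (γ + d) * (D y ^ (-γ) / D y ^ d) := by
            rw [Real.div_rpow hDy.le hhi.le, Real.rpow_sub hDy, Real.rpow_natCast,
              show -γ - (d : ℝ) = -(γ + d) by ring, Real.rpow_neg hhi.le]
            field_simp
          rw [h4]
          field_simp
      _ ≤ ENNReal.ofReal (1 / 2 * (|u y| ^ p * D y ^ (-γ))) := by
          refine ENNReal.ofReal_le_ofReal ?_
          gcongr
      _ = 2⁻¹ * f y := by
          rw [ENNReal.ofReal_mul (by norm_num)]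
          congr 1
          rw [one_div, ENNReal.ofReal_inv_of_pos (by norm_num)]
          simp
  have hGint : ∫⁻ x in G, f x ≤ ENNReal.ofReal c₁ * (∫⁻ x in Ω, J x) + 2⁻¹ * ∫⁻ y in Ω, f y := by
    calc ∫⁻ x in G, f x ≤ ∫⁻ x in G, (ENNReal.ofReal c₁ * J x + ∫⁻ y, h x y) :=
          setLIntegral_mono' hG hpoint
      _ = (∫⁻ x in G, ENNReal.ofReal c₁ * J x) + ∫⁻ x in G, ∫⁻ y, h x y :=
          lintegral_add_right _ hhm.lintegral_prod_right
      _ ≤ _ := by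
          gcongr ?_ + ?_
          · rw [lintegral_const_mul' _ _ ENNReal.ofReal_ne_top]
            gcongr
          · exact (setLIntegral_le_lintegral _ _).trans hswap
  have hsplit : ∫⁻ x in Ω, f x = (∫⁻ x in G, f x) + ∫⁻ x in Ω \ G, f x := by
    rw [← lintegral_inter_add_sdiff f Ω hG, inter_eq_self_of_subset_right hGΩ]
  have key : ∫⁻ x in Ω, f x ≤
      2⁻¹ * (∫⁻ x in Ω, f x) + (ENNReal.ofReal c₁ * (∫⁻ x in Ω, J x) + ∫⁻ x in Ω \ G, f x) := by
    calc ∫⁻ x in Ω, f x = (∫⁻ x in G, f x) + ∫⁻ x in Ω \ G, f x := hsplit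
      _ ≤ (ENNReal.ofReal c₁ * (∫⁻ x in Ω, J x) + 2⁻¹ * ∫⁻ y in Ω, f y) +
          ∫⁻ x in Ω \ G, f x := by gcongr
      _ = _ := by ring
  refine (le_two_mul_of_le_half_add hfin.ne key).trans (le_of_eq ?_)
  rw [mul_add, ENNReal.ofReal_mul zero_le_two (q := c₁), ENNReal.ofReal_ofNat, mul_assoc]

/-- The volume of the unit ball of `ℝ^d`, as a real number. -/
noncomputable def unitBallVolume (d : ℕ) : ℝ := (volume (ball (0 : Rd d) 1)).toReal

theorem unitBallVolume_pos (d : ℕ) : 0 < unitBallVolume d :=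
  ENNReal.toReal_pos (measure_ball_pos _ _ one_pos).ne' measure_ball_lt_top.ne

theorem volume_ball_eq {d : ℕ} (x : Rd d) {r : ℝ} (hr : 0 < r) :
    volume (ball x r) = ENNReal.ofReal (unitBallVolume d * r ^ d) := by
  rw [Measure.addHaar_ball_of_pos _ _ hr, finrank_euclideanSpace_fin, mul_comm,
    ENNReal.ofReal_mul (unitBallVolume_pos d).le, unitBallVolume,
    ENNReal.ofReal_toReal measure_ball_lt_top.ne]

theorem exists_dist_eq_distBd {d : ℕ} {Ω : Set (Rd d)} (hE : (frontier Ω).Nonempty) (x : Rd d) :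
    ∃ w ∈ frontier Ω, dist x w = distBd Ω x := by
  obtain ⟨w, hw, h⟩ := isClosed_frontier.exists_infDist_eq_dist hE x
  exact ⟨w, hw, h.symm⟩

theorem exists_dist_le_of_mem_cthickening {d : ℕ} {E : Set (Rd d)} (hc : IsClosed E)
    (hE : E.Nonempty) {r : ℝ} (hr : 0 ≤ r) {t : Rd d} (ht : t ∈ cthickening r E) :
    ∃ e ∈ E, dist t e ≤ r := by
  obtain ⟨e, he, h⟩ := hc.exists_infDist_eq_dist hE t
  refine ⟨e, he, h ▸ ?_⟩
  exact ENNReal.toReal_le_of_le_ofReal hr (mem_cthickening_iff.1 ht)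

theorem distBd_le_dist {d : ℕ} {Ω : Set (Rd d)} {x w : Rd d} (hw : w ∈ frontier Ω) :
    distBd Ω x ≤ dist x w := infDist_le_dist_of_mem hw

theorem distBd_le_add_dist {d : ℕ} (Ω : Set (Rd d)) (x y : Rd d) :
    distBd Ω y ≤ distBd Ω x + dist x y := by
  rw [dist_comm]
  exact infDist_le_infDist_add_dist

/-- A ball contained in `Ω` stays away from `∂Ω`. -/
theorem sub_dist_le_distBd {d : ℕ} {Ω : Set (Rd d)} (hopen : IsOpen Ω)
    (hE : (frontier Ω).Nonempty) {z y : Rd d} {ρ : ℝ} (hb : ball z ρ ⊆ Ω) :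
    ρ - dist y z ≤ distBd Ω y := by
  refine (le_infDist hE).2 fun w hw => ?_
  have hwz : ρ ≤ dist w z := by
    by_contra! h
    rw [hopen.frontier_eq] at hw
    exact hw.2 (hb h)
  have := dist_triangle_left w z y
  linarith

theorem half_lt_distBd_of_mem_ball {d : ℕ} {Ω : Set (Rd d)} (hopen : IsOpen Ω)
    (hE : (frontier Ω).Nonempty) {z y : Rd d} {ρ : ℝ} (hb : ball z ρ ⊆ Ω)
    (hy : y ∈ ball z (ρ / 2)) : ρ / 2 < distBd Ω y := by
  have := sub_dist_le_distBd hopen hE (y := y) hb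
  rw [mem_ball] at hy
  linarith

theorem ofReal_lt_ediam_of_lt_distBd {d : ℕ} {Ω : Set (Rd d)} (hE : (frontier Ω).Nonempty)
    {x : Rd d} (hx : x ∈ Ω) {r : ℝ} (hr : r < distBd Ω x) (hpos : 0 < distBd Ω x) :
    ENNReal.ofReal r < EMetric.diam Ω := by
  obtain ⟨w, hw, h⟩ := exists_dist_eq_distBd hE x
  calc ENNReal.ofReal r < ENNReal.ofReal (distBd Ω x) := (ENNReal.ofReal_lt_ofReal_iff hpos).2 hr
    _ = edist x w := by rw [edist_dist, h]
    _ ≤ Metric.ediam (closure Ω) :=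
        Metric.edist_le_ediam_of_mem (subset_closure hx) (frontier_subset_closure hw)
    _ = _ := Metric.ediam_closure Ω

theorem exists_ray_mem_frontier {d : ℕ} {Ω : Set (Rd d)} (hopen : IsOpen Ω)
    (hb : Bornology.IsBounded Ω) {x e : Rd d} (hx : x ∈ Ω) (he : ‖e‖ = 1) :
    ∃ t : ℝ, 0 ≤ t ∧ x + t • e ∈ frontier Ω := by
  by_contra! H
  have hcont : Continuous fun t : ℝ => x + t • e := by fun_prop
  obtain ⟨ρ, hρ⟩ := hb.subset_ball x
  have hpre : IsPreconnected ((fun t : ℝ => x + t • e) '' Ici 0) :=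
    isPreconnected_Ici.image _ hcont.continuousOn
  have hsub := (isPreconnected_iff_subset_of_disjoint.1 hpre) Ω (closure Ω)ᶜ hopen
    isClosed_closure.isOpen_compl ?_ ?_
  · rcases hsub with h | h
    · have hρ0 : 0 < ρ := by simpa using hρ hx
      have := hρ (h ⟨ρ, hρ0.le, rfl⟩)
      simp [norm_smul, he, abs_of_pos hρ0] at this
    · exact h ⟨0, by simp, by simp⟩ (subset_closure hx)
  · rintro _ ⟨t, ht, rfl⟩
    by_cases hc : x + t • e ∈ Ω
    · exact Or.inl hc
    · refine Or.inr fun hcl => H t ht ?_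
      rw [hopen.frontier_eq]
      exact ⟨hcl, hc⟩
  · ext y
    simp only [mem_inter_iff, mem_compl_iff, mem_empty_iff_false, iff_false]
    rintro ⟨-, hy, hyc⟩
    exact hyc (subset_closure hy)

theorem ofReal_distBd_lt_ediam_frontier {d : ℕ} {Ω : Set (Rd d)} (hopen : IsOpen Ω)
    (hE : (frontier Ω).Nonempty)
    (hb : Bornology.IsBounded Ω ∨ ¬ Bornology.IsBounded (frontier Ω)) {x : Rd d} (hx : x ∈ Ω) :
    ENNReal.ofReal (distBd Ω x) < EMetric.diam (frontier Ω) := by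
  rcases hb with hb | hb
  · have hpos := distBd_pos hopen hE hx
    obtain ⟨w, hw, hxw⟩ := exists_dist_eq_distBd hE x
    set v := w - x with hv
    have hv0 : ‖v‖ ≠ 0 := by
      rw [hv, ← dist_eq_norm, dist_comm, hxw]; exact hpos.ne'
    set e := ‖v‖⁻¹ • v with he
    have hne : ‖e‖ = 1 := by rw [he, norm_smul, norm_inv, norm_norm, inv_mul_cancel₀ hv0]
    obtain ⟨t₁, ht₁, h₁⟩ := exists_ray_mem_frontier hopen hb hx hne
    obtain ⟨t₂, ht₂, h₂⟩ := exists_ray_mem_frontier hopen hb hx (e := -e) (by rwa [norm_neg])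
    have hd₁ := distBd_le_dist (x := x) h₁
    have hd₂ := distBd_le_dist (x := x) h₂
    rw [dist_self_add_right, norm_smul, hne, Real.norm_of_nonneg ht₁, mul_one] at hd₁
    rw [dist_self_add_right, norm_smul, norm_neg, hne, Real.norm_of_nonneg ht₂, mul_one] at hd₂
    have hd : dist (x + t₁ • e) (x + t₂ • -e) = t₁ + t₂ := by
      rw [dist_add_left, dist_eq_norm, smul_neg, sub_neg_eq_add, ← add_smul, norm_smul, hne,
        Real.norm_of_nonneg (by positivity), mul_one]
    calc ENNReal.ofReal (distBd Ω x) < ENNReal.ofReal (t₁ + t₂) :=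
          (ENNReal.ofReal_lt_ofReal_iff (by linarith)).2 (by linarith)
      _ = edist (x + t₁ • e) (x + t₂ • -e) := by rw [edist_dist, hd]
      _ ≤ _ := Metric.edist_le_ediam_of_mem h₁ h₂
  · have : Metric.ediam (frontier Ω) = ⊤ := by
      by_contra h
      exact hb (Metric.isBounded_iff_ediam_ne_top.2 h)
    exact (ENNReal.ofReal_lt_top).trans_eq this.symm

theorem mul_volume_le_of_forall_ball {d : ℕ} {S A : Set (Rd d)} (hS : MeasurableSet S)
    (hA : MeasurableSet A) {ρ : ℝ} (hρ : 0 < ρ) {a : ℝ≥0∞}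
    (h : ∀ t ∈ S, a ≤ volume (A ∩ ball t ρ)) :
    a * volume S ≤ ENNReal.ofReal (unitBallVolume d * ρ ^ d) * volume A := by
  set P : Set (Rd d × Rd d) := {z | z.2 ∈ A ∧ dist z.2 z.1 < ρ} with hP
  have hPm : MeasurableSet P :=
    (measurable_snd hA).inter
      (isOpen_lt (continuous_snd.dist continuous_fst) continuous_const).measurableSet
  have hfm : Measurable (P.indicator fun _ => (1 : ℝ≥0∞)) := measurable_const.indicator hPm
  calc a * volume S = ∫⁻ _ in S, a := (setLIntegral_const S a).symm
    _ ≤ ∫⁻ t in S, ∫⁻ y, P.indicator (fun _ => (1 : ℝ≥0∞)) (t, y) := by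
        refine setLIntegral_mono' hS fun t ht => (h t ht).trans (le_of_eq ?_)
        rw [← lintegral_indicator_one (hA.inter measurableSet_ball)]
        rfl
    _ ≤ ∫⁻ t, ∫⁻ y, P.indicator (fun _ => (1 : ℝ≥0∞)) (t, y) := setLIntegral_le_lintegral _ _
    _ = ∫⁻ y, ∫⁻ t, P.indicator (fun _ => (1 : ℝ≥0∞)) (t, y) :=
        lintegral_lintegral_swap (f := fun t y => P.indicator (fun _ => (1 : ℝ≥0∞)) (t, y))
          hfm.aemeasurable
    _ ≤ ∫⁻ y, A.indicator (fun _ => ENNReal.ofReal (unitBallVolume d * ρ ^ d)) y := by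
        refine lintegral_mono fun y => ?_
        by_cases hy : y ∈ A
        · rw [indicator_of_mem hy, ← volume_ball_eq y hρ,
            ← lintegral_indicator_one measurableSet_ball]
          refine lintegral_mono fun t => ?_
          refine le_of_eq ?_
          by_cases ht : t ∈ ball y ρ
          · have hz : (t, y) ∈ P := ⟨hy, mem_ball'.1 ht⟩
            rw [indicator_of_mem hz, indicator_of_mem ht]
            rfl
          · have hz : (t, y) ∉ P := fun hz => ht (mem_ball'.2 hz.2)
            rw [indicator_of_notMem hz, indicator_of_notMem ht]
        · have : ∀ t, P.indicator (fun _ => (1 : ℝ≥0∞)) (t, y) = 0 := fun t =>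
            indicator_of_notMem (fun hz => hy hz.1) _
          simp [this]
    _ = _ := by rw [lintegral_indicator hA, setLIntegral_const]

theorem measurableSet_comparableSet {d : ℕ} {Ω : Set (Rd d)} (hopen : IsOpen Ω) (lo hi R : ℝ)
    (x : Rd d) : MeasurableSet (comparableSet Ω lo hi R x) :=
  measurable_prodMk_left (measurableSet_comparable hopen lo hi R)

/-- Near a fat boundary, a plump set contains many points at the small scale `d_Ω(x) / M`. -/
theorem le_volume_comparableSet_of_upperCodim {d : ℕ} {Ω : Set (Rd d)} (hopen : IsOpen Ω)
    (hE : (frontier Ω).Nonempty) {κ : ℝ} (hκ0 : 0 < κ) (hκ1 : κ < 1) (hplump : IsPlump κ Ω)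
    (hb : Bornology.IsBounded Ω ∨ ¬ Bornology.IsBounded (frontier Ω)) {q c : ℝ} (hc : 0 < c)
    (hq : ∀ x ∈ frontier Ω, ∀ r R : ℝ, 0 < r → r < R →
      ENNReal.ofReal R < EMetric.diam (frontier Ω) →
      ENNReal.ofReal (c * (r / R) ^ q) * volume (Metric.ball x R)
        ≤ volume (Metric.cthickening r (frontier Ω) ∩ Metric.ball x R))
    {M : ℝ} (hM : 1 < M) {x : Rd d} (hx : x ∈ Ω) :
    ENNReal.ofReal ((κ / 8) ^ d * (c * M ^ (-q) * unitBallVolume d) * distBd Ω x ^ d)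
      ≤ volume (comparableSet Ω (κ / (2 * M)) (2 / M) 5 x) := by
  set δ := distBd Ω x with hδ
  have hδ0 : 0 < δ := distBd_pos hopen hE hx
  have hM0 : 0 < M := by linarith
  set r := δ / M with hr
  have hr0 : 0 < r := by positivity
  have hrδ : r < δ := div_lt_self hδ0 hM
  have hv := unitBallVolume_pos d
  obtain ⟨w, hw, hxw⟩ := exists_dist_eq_distBd hE x
  set S := cthickening r (frontier Ω) ∩ ball w δ with hS
  have hSm : MeasurableSet S := isClosed_cthickening.measurableSet.inter measurableSet_ball
  have hSvol : ENNReal.ofReal (c * M ^ (-q) * (unitBallVolume d * δ ^ d)) ≤ volume S := by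
    refine le_trans (le_of_eq ?_)
      (hq w hw r δ hr0 hrδ (ofReal_distBd_lt_ediam_frontier hopen hE hb hx))
    rw [volume_ball_eq w hδ0, ← ENNReal.ofReal_mul (by positivity)]
    have : r / δ = M⁻¹ := by rw [hr]; field_simp
    rw [this, Real.inv_rpow hM0.le, Real.rpow_neg hM0.le]
  have hloc : ∀ t ∈ S, ENNReal.ofReal (unitBallVolume d * (κ * r / 2) ^ d) ≤
      volume (comparableSet Ω (κ / (2 * M)) (2 / M) 5 x ∩ ball t (4 * r)) := by
    rintro t ⟨ht, htw⟩
    obtain ⟨e, he, hte⟩ := exists_dist_le_of_mem_cthickening isClosed_frontier hE hr0.le ht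
    obtain ⟨z, hz, hzΩ⟩ := hplump r hr0 (ofReal_lt_ediam_of_lt_distBd hE hx hrδ hδ0) e
      (frontier_subset_closure he)
    rw [← volume_ball_eq z (by positivity)]
    refine measure_mono fun y hy => ?_
    have hyd := half_lt_distBd_of_mem_ball hopen hE hzΩ hy
    rw [mem_ball] at hy htw
    rw [mem_closedBall] at hz
    have hκr : κ * r < r := by nlinarith
    have h1 := dist_triangle y z e
    have h2 := dist_triangle_right y t e
    have h4 := dist_triangle4 x w t y
    rw [dist_comm t y, dist_comm w t] at h4
    refine ⟨⟨hzΩ ?_, ?_, ?_, ?_⟩, ?_⟩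
    · rw [mem_ball]; nlinarith
    · rw [show κ / (2 * M) * distBd Ω x = κ * r / 2 by rw [hr, ← hδ]; field_simp]
      exact hyd
    · rw [show 2 / M * distBd Ω x = 2 * r by rw [hr, ← hδ]; field_simp]
      have := distBd_le_dist (x := y) he
      linarith
    · have : dist x y < 5 * δ := by linarith
      exact this
    · rw [mem_ball]; linarith
  have hmul := mul_volume_le_of_forall_ball hSm (measurableSet_comparableSet hopen _ _ _ x)
    (by positivity : 0 < 4 * r) hloc
  have hb0 : 0 < unitBallVolume d * (4 * r) ^ d := by positivity
  refine (ENNReal.mul_le_mul_iff_right (ENNReal.ofReal_pos.2 hb0).ne' ENNReal.ofReal_ne_top).1 ?_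
  refine le_trans (le_trans (le_of_eq ?_) (mul_le_mul_right hSvol _)) hmul
  rw [← ENNReal.ofReal_mul (by positivity), ← ENNReal.ofReal_mul (by positivity)]
  congr 1
  rw [show κ * r / 2 = κ / 8 * (4 * r) by ring, mul_pow (κ / 8)]
  ring

/-- A plump set contains a large piece at the large scale `M d_Ω(x)`. -/
theorem le_volume_comparableSet_of_isPlump {d : ℕ} {Ω : Set (Rd d)} (hopen : IsOpen Ω)
    (hE : (frontier Ω).Nonempty) {κ : ℝ} (hκ0 : 0 < κ) (hκ1 : κ < 1) (hplump : IsPlump κ Ω)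
    {M : ℝ} (hM : 1 < M) {x : Rd d} (hx : x ∈ Ω)
    (hdiam : ENNReal.ofReal (M * distBd Ω x) < EMetric.diam Ω) :
    ENNReal.ofReal (unitBallVolume d * (κ / 2 * M) ^ d * distBd Ω x ^ d)
      ≤ volume (comparableSet Ω (κ * M / 2) (3 * M) (2 * M) x) := by
  set δ := distBd Ω x with hδ
  have hδ0 : 0 < δ := distBd_pos hopen hE hx
  have hM0 : 0 < M := by linarith
  obtain ⟨z, hz, hzΩ⟩ := hplump (M * δ) (by positivity) hdiam x (subset_closure hx)
  have e : unitBallVolume d * (κ / 2 * M) ^ d * δ ^ d =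
      unitBallVolume d * (κ * (M * δ) / 2) ^ d := by
    rw [mul_assoc, ← mul_pow]; congr 2; ring
  rw [e, ← volume_ball_eq z (by positivity)]
  refine measure_mono fun y hy => ?_
  have hyd := half_lt_distBd_of_mem_ball hopen hE hzΩ hy
  rw [mem_ball] at hy
  rw [mem_closedBall] at hz
  have hMδ : 0 < M * δ := by positivity
  have hκM : κ * (M * δ) < M * δ := by nlinarith
  have hδM : δ < M * δ := by nlinarith
  have h1 := dist_triangle x z y
  rw [dist_comm x z, dist_comm z y] at h1
  refine ⟨hzΩ ?_, ?_, ?_, ?_⟩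
  · rw [mem_ball]; nlinarith
  · rw [show κ * M / 2 * distBd Ω x = κ * (M * δ) / 2 by rw [hδ]; ring]
    exact hyd
  · have := distBd_le_add_dist Ω x y
    have h2 : distBd Ω y < 3 * M * δ := by linarith
    exact h2
  · have h2 : dist x y < 2 * M * δ := by linarith
    exact h2

theorem le_natCast_of_mem_lowerCodimSet {d : ℕ} {E : Set (Rd d)} (hE : E.Nonempty)
    (hdiam : 0 < EMetric.diam E) {q : ℝ} (hq : q ∈ lowerCodimSet E) : q ≤ d := by
  obtain ⟨-, C, hC, H⟩ := hq
  by_contra! hlt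
  obtain ⟨x, hx⟩ := hE
  obtain ⟨R, hR0, hR⟩ : ∃ R : ℝ, 0 < R ∧ ENNReal.ofReal R < EMetric.diam E := by
    obtain ⟨b, hb0, hb⟩ := ENNReal.lt_iff_exists_nnreal_btwn.1 hdiam
    exact ⟨b, by exact_mod_cast hb0, by simpa using hb⟩
  have hv := unitBallVolume_pos d
  set t : ℝ := (C + 1) ^ (-(q - d)⁻¹) with ht
  have hqd : 0 < q - d := by linarith
  have ht0 : 0 < t := by positivity
  have ht1 : t < 1 := Real.rpow_lt_one_of_one_lt_of_neg (by linarith) (by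
    have : 0 < (q - (d : ℝ))⁻¹ := by positivity
    linarith)
  have h := H x hx (t * R) R (by positivity) (by nlinarith) hR
  have hsub : ball x (t * R) ⊆ cthickening (t * R) E ∩ ball x R := by
    intro y hy
    refine ⟨mem_cthickening_of_dist_le y x _ E hx (mem_ball.1 hy).le, ?_⟩
    exact ball_subset_ball (by nlinarith) hy
  have h' := (measure_mono hsub).trans h
  rw [volume_ball_eq x (by positivity), volume_ball_eq x hR0,
    ← ENNReal.ofReal_mul (by positivity), ENNReal.ofReal_le_ofReal_iff (by positivity),
    mul_div_assoc, div_self hR0.ne', mul_one, mul_pow] at h'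
  have h2 : t ^ d ≤ C * t ^ q := by
    have hpos : 0 < unitBallVolume d * R ^ d := by positivity
    refine le_of_mul_le_mul_right ?_ hpos
    linarith
  have h3 : t ^ (q - d) * (C + 1) = 1 := by
    rw [ht, ← Real.rpow_mul (by linarith), neg_mul, inv_mul_cancel₀ hqd.ne', Real.rpow_neg_one]
    exact inv_mul_cancel₀ (by linarith)
  have h4 : t ^ q = t ^ (q - d) * t ^ d := by
    rw [← Real.rpow_natCast, ← Real.rpow_add ht0]; congr 1; ring
  rw [h4] at h2
  have h5 : (1 : ℝ) ≤ C * t ^ (q - d) := by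
    have htd : 0 < t ^ d := by positivity
    refine le_of_mul_le_mul_right ?_ htd
    linarith
  have h6 : 0 < t ^ (q - d) := by positivity
  linarith

/-- For a set of positive diameter, the volume bound defining the lower Assouad codimension
extends to all radii. -/
theorem exists_volume_cthickening_le {d : ℕ} {E : Set (Rd d)} (hc : IsClosed E)
    (hE : E.Nonempty) (hdiam : 0 < EMetric.diam E) {q : ℝ} (hq : q ∈ lowerCodimSet E) :
    ∃ C : ℝ, 0 < C ∧ ∀ x ∈ E, ∀ r R : ℝ, 0 < r → r < R →
      volume (cthickening r E ∩ ball x R) ≤ ENNReal.ofReal (C * (r ^ q * R ^ (d - q))) := by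
  have hqd := le_natCast_of_mem_lowerCodimSet hE hdiam hq
  obtain ⟨hq0, C, hC, H⟩ := hq
  have hv := unitBallVolume_pos d
  have hqd' : 0 ≤ (d : ℝ) - q := by linarith
  have hsmall : ∀ x ∈ E, ∀ r R : ℝ, 0 < r → r < R → ENNReal.ofReal R < EMetric.diam E →
      volume (cthickening r E ∩ ball x R) ≤
        ENNReal.ofReal (C * unitBallVolume d * (r ^ q * R ^ (d - q))) := by
    intro x hx r R hr hrR hR
    have hR0 : 0 < R := hr.trans hrR
    refine (H x hx r R hr hrR hR).trans (le_of_eq ?_)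
    rw [volume_ball_eq x hR0, ← ENNReal.ofReal_mul (by positivity)]
    congr 1
    rw [Real.div_rpow hr.le hR0.le, Real.rpow_sub hR0, Real.rpow_natCast]
    field_simp
  by_cases hbd : Metric.ediam E = ⊤
  · exact ⟨C * unitBallVolume d, by positivity, fun x hx r R hr hrR =>
      hsmall x hx r R hr hrR (ENNReal.ofReal_lt_top.trans_eq hbd.symm)⟩
  have hbounded : Bornology.IsBounded E := Metric.isBounded_iff_ediam_ne_top.2 hbd
  set D := Metric.diam E with hD
  have hDE : ENNReal.ofReal D = EMetric.diam E := ENNReal.ofReal_toReal hbd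
  have hD0 : 0 < D := ENNReal.toReal_pos hdiam.ne' hbd
  obtain ⟨T, hTE, hTfin, hTcov⟩ :=
    (Metric.isCompact_of_isClosed_isBounded hc hbounded).finite_cover_balls
      (by positivity : 0 < D / 4)
  set N : ℝ := (hTfin.toFinset.card : ℝ) with hN
  refine ⟨C * unitBallVolume d + N * (C * unitBallVolume d) + 6 ^ d * unitBallVolume d,
    by positivity, fun x hx r R hr hrR => ?_⟩
  have hR0 : 0 < R := hr.trans hrR
  have hpow : 0 ≤ r ^ q * R ^ ((d : ℝ) - q) := by positivity
  have hCv : 0 < C * unitBallVolume d := by positivity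
  have hN0 : 0 ≤ N := by positivity
  rcases lt_or_ge R D with hRD | hRD
  · refine (hsmall x hx r R hr hrR ?_).trans (ENNReal.ofReal_le_ofReal ?_)
    · rw [← hDE]; exact (ENNReal.ofReal_lt_ofReal_iff hD0).2 hRD
    · refine mul_le_mul_of_nonneg_right ?_ hpow
      have : 0 < (6 : ℝ) ^ d * unitBallVolume d := by positivity
      nlinarith
  rcases lt_or_ge r (D / 4) with hrD | hrD
  · have hcov : cthickening r E ∩ ball x R ⊆
        ⋃ i ∈ hTfin.toFinset, (cthickening r E ∩ ball i (D / 2)) := by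
      rintro y ⟨hy, -⟩
      obtain ⟨e, he, hye⟩ := exists_dist_le_of_mem_cthickening hc hE hr.le hy
      obtain ⟨i, hi, hei⟩ := mem_iUnion₂.1 (hTcov he)
      refine mem_iUnion₂.2 ⟨i, hTfin.mem_toFinset.2 hi, hy, ?_⟩
      rw [mem_ball] at hei ⊢
      have := dist_triangle y e i
      linarith
    calc volume (cthickening r E ∩ ball x R)
        ≤ ∑ i ∈ hTfin.toFinset, volume (cthickening r E ∩ ball i (D / 2)) :=
          (measure_mono hcov).trans (measure_biUnion_finset_le _ _)
      _ ≤ ∑ i ∈ hTfin.toFinset,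
          ENNReal.ofReal (C * unitBallVolume d * (r ^ q * R ^ ((d : ℝ) - q))) := by
          refine Finset.sum_le_sum fun i hi => ?_
          refine (hsmall i (hTE (hTfin.mem_toFinset.1 hi)) r (D / 2) hr (by linarith) ?_).trans
            (ENNReal.ofReal_le_ofReal ?_)
          · rw [← hDE]; exact (ENNReal.ofReal_lt_ofReal_iff hD0).2 (by linarith)
          · gcongr
            linarith
      _ = ENNReal.ofReal (N * (C * unitBallVolume d) * (r ^ q * R ^ ((d : ℝ) - q))) := by
          rw [Finset.sum_const, nsmul_eq_mul, mul_assoc N, ENNReal.ofReal_mul hN0, hN,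
            ENNReal.ofReal_natCast]
      _ ≤ _ := by
          refine ENNReal.ofReal_le_ofReal (mul_le_mul_of_nonneg_right ?_ hpow)
          have : 0 < (6 : ℝ) ^ d * unitBallVolume d := by positivity
          linarith
  · have hsub : cthickening r E ∩ ball x R ⊆ ball x (6 * r) := by
      rintro y ⟨hy, -⟩
      obtain ⟨e, he, hye⟩ := exists_dist_le_of_mem_cthickening hc hE hr.le hy
      have h1 := dist_triangle y e x
      have h2 := Metric.dist_le_diam_of_mem hbounded he hx
      rw [mem_ball]
      linarith
    refine (measure_mono hsub).trans ?_
    rw [volume_ball_eq x (by positivity)]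
    refine ENNReal.ofReal_le_ofReal ?_
    have h1 : r ^ d ≤ r ^ q * R ^ ((d : ℝ) - q) := by
      calc r ^ d = r ^ q * r ^ ((d : ℝ) - q) := by
            rw [← Real.rpow_add hr, ← Real.rpow_natCast]; congr 1; ring
        _ ≤ _ := by gcongr
    calc unitBallVolume d * (6 * r) ^ d = 6 ^ d * unitBallVolume d * r ^ d := by
          rw [mul_pow]; ring
      _ ≤ 6 ^ d * unitBallVolume d * (r ^ q * R ^ ((d : ℝ) - q)) := by gcongr
      _ ≤ _ := by
          refine mul_le_mul_of_nonneg_right ?_ hpow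
          nlinarith

theorem exists_one_lt_mul_rpow_le_half (K : ℝ) {ε : ℝ} (hε : 0 < ε) :
    ∃ M : ℝ, 1 < M ∧ K * M ^ (-ε) ≤ 1 / 2 := by
  have h : Tendsto (fun M : ℝ => K * M ^ (-ε)) atTop (nhds (K * 0)) :=
    (tendsto_rpow_neg_atTop hε).const_mul K
  rw [mul_zero] at h
  obtain ⟨M, hM, hK⟩ :=
    ((eventually_gt_atTop 1).and (h.eventually (ge_mem_nhds (by norm_num : (0 : ℝ) < 1 / 2)))).exists
  exact ⟨M, hM, hK⟩

theorem exists_mem_lowerCodimSet {d : ℕ} {E : Set (Rd d)} {γ : ℝ} (hγ0 : 0 ≤ γ)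
    (hγ : γ < lowerCodimA E) : 0 < EMetric.diam E ∧ ∃ q ∈ lowerCodimSet E, γ < q := by
  have hbdd : BddAbove (lowerCodimSet E) := by
    by_contra h
    rw [lowerCodimA, Real.sSup_of_not_bddAbove h] at hγ
    linarith
  constructor
  · by_contra h
    have h0 : EMetric.diam E = 0 := nonpos_iff_eq_zero.1 (not_lt.1 h)
    obtain ⟨b, hb⟩ := hbdd
    have hmem : |b| + 1 ∈ lowerCodimSet E := by
      refine ⟨by positivity, 1, le_rfl, fun x _ r R _ _ hR => ?_⟩
      rw [h0] at hR
      exact absurd hR not_lt_zero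
    have := hb hmem
    have := le_abs_self b
    linarith
  · refine exists_lt_of_lt_csSup ?_ hγ
    by_contra h
    rw [not_nonempty_iff_eq_empty] at h
    rw [lowerCodimA, h, Real.sSup_empty] at hγ
    linarith

theorem exists_upperCodim_lt {d : ℕ} {E : Set (Rd d)} {γ : ℝ} (hγ : upperCodimA E < γ) :
    ∃ q < γ, ∃ c : ℝ, 0 < c ∧ ∀ x ∈ E, ∀ r R : ℝ, 0 < r → r < R →
      ENNReal.ofReal R < EMetric.diam E →
      ENNReal.ofReal (c * (r / R) ^ q) * volume (Metric.ball x R)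
        ≤ volume (Metric.cthickening r E ∩ Metric.ball x R) := by
  refine (exists_lt_of_csInf_lt ?_ hγ).elim fun q ⟨⟨_, hq⟩, hqγ⟩ => ⟨q, hqγ, hq⟩
  refine ⟨d, by positivity, 1, one_pos, fun x hx r R hr hrR _ => ?_⟩
  have hR : 0 < R := hr.trans hrR
  have hv := unitBallVolume_pos d
  refine le_trans (le_of_eq ?_) (measure_mono (s := ball x r) fun y hy =>
    ⟨mem_cthickening_of_dist_le y x _ E hx (mem_ball.1 hy).le, ball_subset_ball hrR.le hy⟩)
  rw [volume_ball_eq x hR, volume_ball_eq x hr, ← ENNReal.ofReal_mul (by positivity),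
    Real.rpow_natCast, div_pow]
  congr 1
  field_simp

theorem hardy_of_lt_lowerCodimA {d : ℕ} {Ω : Set (Rd d)} (hopen : IsOpen Ω)
    (hE : (frontier Ω).Nonempty) {κ : ℝ} (hκ0 : 0 < κ) (hκ1 : κ < 1) (hplump : IsPlump κ Ω)
    {s p α β : ℝ} (hs : 0 < s) (hp : 0 < p) (hα : 0 ≤ α) (hβ : 0 ≤ β)
    (hγ : s * p + α + β < lowerCodimA (frontier Ω)) :
    ∃ c M : ℝ, 0 < c ∧ 1 < M ∧ ∀ u : Rd d → ℝ, Measurable u →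
      (∫⁻ x in Ω, ENNReal.ofReal (|u x| ^ p * distBd Ω x ^ (-(s * p + α + β)))) < ⊤ →
      (∫⁻ x in Ω, ENNReal.ofReal (|u x| ^ p * distBd Ω x ^ (-(s * p + α + β))))
        ≤ ENNReal.ofReal c *
            (∫⁻ x in Ω, ∫⁻ y in Ω ∩ Metric.ball x (2 * M * distBd Ω x), ENNReal.ofReal
              (|u x - u y| ^ p / dist x y ^ ((d : ℝ) + s * p)
                * distBd Ω y ^ (-β) * distBd Ω x ^ (-α)))
          + 2 * ∫⁻ x in Ω \ {x ∈ Ω | ENNReal.ofReal (M * distBd Ω x) < EMetric.diam Ω},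
              ENNReal.ofReal (|u x| ^ p * distBd Ω x ^ (-(s * p + α + β))) := by
  have hγ0 : 0 < s * p + α + β := by positivity
  obtain ⟨hdiam, q, hq, hγq⟩ := exists_mem_lowerCodimSet hγ0.le hγ
  obtain ⟨C, hC, hvol⟩ := exists_volume_cthickening_le isClosed_frontier hE hdiam hq
  set γ := s * p + α + β with hγdef
  have hv := unitBallVolume_pos d
  set B : ℝ := C * ((2 / κ) ^ q * (4 / κ + 1) ^ ((d : ℝ) - q)) with hB
  have hB0 : 0 < B := by positivity
  obtain ⟨M, hM, hKM⟩ := exists_one_lt_mul_rpow_le_half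
    (2 ^ p / (unitBallVolume d * (κ / 2) ^ d) * (3 ^ (γ + d) * B)) (sub_pos.2 hγq)
  have hM0 : 0 < M := by linarith
  have hGm : MeasurableSet {x ∈ Ω | ENNReal.ofReal (M * distBd Ω x) < EMetric.diam Ω} :=
    hopen.measurableSet.inter ((isOpen_lt (ENNReal.continuous_ofReal.comp
      (continuous_const.mul (continuous_distBd Ω))) continuous_const).measurableSet)
  refine (hardy_of_comparableSet (s := s) (p := p) (α := α) (β := β) hopen hE hGm
    (fun x hx => hx.1) hs hp hα hβ
    (lo := κ * M / 2) (hi := 3 * M) (R := 2 * M) (m := unitBallVolume d * (κ / 2 * M) ^ d)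
    (V := B * M ^ (-q)) (by positivity) (by positivity) (by positivity)
    (fun x hx => le_volume_comparableSet_of_isPlump hopen hE hκ0 hκ1 hplump hM hx.1 hx.2) ?_ ?_).elim
    fun c ⟨hc, h⟩ => ⟨c, M, hc, hM, h⟩
  · intro y hy
    have hδ0 := distBd_pos hopen hE hy
    obtain ⟨w, hw, hyw⟩ := exists_dist_eq_distBd hE y
    set δ := distBd Ω y with hδ
    have hr0 : 0 < 2 / κ * M⁻¹ * δ := by positivity
    have hrR : 2 / κ * M⁻¹ * δ < (4 / κ + 1) * δ := by
      have hMi : M⁻¹ < 1 := inv_lt_one_of_one_lt₀ hM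
      have h2κ : 0 < 2 / κ := by positivity
      have h4κ : 4 / κ = 2 * (2 / κ) := by ring
      refine mul_lt_mul_of_pos_right ?_ hδ0
      nlinarith
    refine (measure_mono ?_).trans ((hvol w hw _ _ hr0 hrR).trans (le_of_eq ?_))
    · rintro x ⟨-, -, hlo, -, hdist⟩
      have hx : distBd Ω x < 2 / κ * M⁻¹ * δ := by
        have e : 2 / κ * M⁻¹ * δ = δ / (κ * M / 2) := by field_simp
        rw [e, lt_div_iff₀ (by positivity)]
        linarith
      have hxy : dist x y < 4 / κ * δ := by
        have e : 4 / κ * δ = 2 * M * (2 / κ * M⁻¹ * δ) := by field_simp; norm_num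
        rw [e]
        exact hdist.trans (by gcongr)
      refine ⟨?_, ?_⟩
      · obtain ⟨v, hv, hxv⟩ := exists_dist_eq_distBd hE x
        exact mem_cthickening_of_dist_le x v _ _ hv (by rw [hxv]; exact hx.le)
      · have := dist_triangle x y w
        rw [mem_ball]
        linarith
    · congr 1
      rw [Real.mul_rpow (by positivity) hδ0.le, Real.mul_rpow (by positivity) (by positivity),
        Real.mul_rpow (by positivity) hδ0.le, Real.inv_rpow hM0.le, ← Real.rpow_neg hM0.le, hB,
        Real.rpow_sub hδ0, Real.rpow_natCast]
      field_simp
  · rw [← hγdef]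
    refine le_trans (le_of_eq ?_) hKM
    have e : M ^ (-(q - γ)) = M ^ (γ + d) * M ^ (-q) / M ^ d := by
      rw [← Real.rpow_natCast, ← Real.rpow_add hM0, ← Real.rpow_sub hM0]; congr 1; ring
    rw [e, Real.mul_rpow (by norm_num) hM0.le, mul_pow]
    field_simp

theorem hardy_of_upperCodimA_lt {d : ℕ} {Ω : Set (Rd d)} (hopen : IsOpen Ω)
    (hE : (frontier Ω).Nonempty) {κ : ℝ} (hκ0 : 0 < κ) (hκ1 : κ < 1) (hplump : IsPlump κ Ω)
    {s p α β : ℝ} (hs : 0 < s) (hp : 0 < p) (hα : 0 ≤ α) (hβ : 0 ≤ β)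
    (hγ : upperCodimA (frontier Ω) < s * p + α + β)
    (hb : Bornology.IsBounded Ω ∨ ¬ Bornology.IsBounded (frontier Ω)) :
    ∃ c : ℝ, 0 < c ∧ ∀ u : Rd d → ℝ, Measurable u →
      (∫⁻ x in Ω, ENNReal.ofReal (|u x| ^ p * distBd Ω x ^ (-(s * p + α + β)))) < ⊤ →
      (∫⁻ x in Ω, ENNReal.ofReal (|u x| ^ p * distBd Ω x ^ (-(s * p + α + β))))
        ≤ ENNReal.ofReal c *
            (∫⁻ x in Ω, ∫⁻ y in Ω ∩ Metric.ball x (5 * distBd Ω x), ENNReal.ofReal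
              (|u x - u y| ^ p / dist x y ^ ((d : ℝ) + s * p)
                * distBd Ω y ^ (-β) * distBd Ω x ^ (-α))) := by
  obtain ⟨q, hqγ, b, hb0, hq⟩ := exists_upperCodim_lt hγ
  set γ := s * p + α + β with hγdef
  have hv := unitBallVolume_pos d
  obtain ⟨M, hM, hKM⟩ := exists_one_lt_mul_rpow_le_half
    (2 ^ p / ((κ / 8) ^ d * b) * (2 ^ (γ + d) * (10 / κ) ^ d)) (sub_pos.2 hqγ)
  have hM0 : 0 < M := by linarith
  refine (hardy_of_comparableSet (s := s) (p := p) (α := α) (β := β) hopen hE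
    hopen.measurableSet Subset.rfl hs hp hα hβ
    (lo := κ / (2 * M)) (hi := 2 / M) (R := 5)
    (m := (κ / 8) ^ d * (b * M ^ (-q) * unitBallVolume d))
    (V := unitBallVolume d * (10 / κ * M) ^ d) (by positivity) (by positivity) (by positivity)
    (fun x hx => le_volume_comparableSet_of_upperCodim hopen hE hκ0 hκ1 hplump hb hb0 hq hM hx)
    ?_ ?_).elim fun c ⟨hc, h⟩ => ⟨c, hc, fun u hu hfin => (h u hu hfin).trans (le_of_eq (by simp))⟩
  · intro y hy
    have hδ0 := distBd_pos hopen hE hy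
    rw [mul_assoc, ← mul_pow, ← volume_ball_eq y (by positivity)]
    refine measure_mono ?_
    rintro x ⟨-, -, hlo, -, hdist⟩
    have hx : distBd Ω x < 2 / κ * M * distBd Ω y := by
      have e : 2 / κ * M * distBd Ω y = distBd Ω y / (κ / (2 * M)) := by field_simp
      rw [e, lt_div_iff₀ (by positivity)]
      linarith
    rw [mem_ball]
    have e : 10 / κ * M * distBd Ω y = 5 * (2 / κ * M * distBd Ω y) := by ring
    rw [e]
    linarith
  · rw [← hγdef]
    refine le_trans (le_of_eq ?_) hKM
    have e : M ^ (-(γ - q)) = M ^ d / (M ^ (γ + d) * M ^ (-q)) := by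
      rw [← Real.rpow_natCast, ← Real.rpow_add hM0, ← Real.rpow_sub hM0]; congr 1; ring
    rw [e, Real.div_rpow (by norm_num) hM0.le, mul_pow (10 / κ)]
    field_simp

/-- the (weak) weighted fractional Hardy inequality on κ-plump open sets,
in the three regimes (T), (T'), (F). -/
theorem stmt8 {d : ℕ} (Ω : Set (Rd d)) (hne : Ω.Nonempty) (hopen : IsOpen Ω)
    (κ : ℝ) (hκ0 : 0 < κ) (hκ1 : κ < 1) (hplump : IsPlump κ Ω)
    (s p α β ξ : ℝ) (hs0 : 0 < s) (hs1 : s < 1) (hp : 0 < p)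
    (hα0 : 0 ≤ α) (hβ0 : 0 ≤ β)
    (hcase :
      (s * p + α + β < lowerCodimA (frontier Ω) ∧ ¬ Bornology.IsBounded Ω ∧ ξ = 0)
      ∨ (s * p + α + β < lowerCodimA (frontier Ω) ∧ Bornology.IsBounded Ω ∧ ξ = 1)
      ∨ (upperCodimA (frontier Ω) < s * p + α + β
          ∧ (Bornology.IsBounded Ω ∨ ¬ Bornology.IsBounded (frontier Ω)) ∧ ξ = 0)) :
    ∃ c R : ℝ, 0 < c ∧ 0 < R ∧ ∀ u : Rd d → ℝ, Measurable u →
      (∫⁻ x in Ω, ENNReal.ofReal (|u x| ^ p * distBd Ω x ^ (-(s * p + α + β)))) < ⊤ →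
      (∫⁻ x in Ω, ENNReal.ofReal (|u x| ^ p * distBd Ω x ^ (-(s * p + α + β))))
        ≤ ENNReal.ofReal c *
            (∫⁻ x in Ω, ∫⁻ y in Ω ∩ Metric.ball x (R * distBd Ω x), ENNReal.ofReal
              (|u x - u y| ^ p / dist x y ^ ((d : ℝ) + s * p)
                * distBd Ω y ^ (-β) * distBd Ω x ^ (-α)))
          + ENNReal.ofReal (c * ξ) * ∫⁻ x in Ω, ENNReal.ofReal (|u x| ^ p) := by
  have hγ0 : 0 < s * p + α + β := by positivity
  rcases (frontier Ω).eq_empty_or_nonempty with hE | hE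
  · refine ⟨1, 1, one_pos, one_pos, fun u _ _ => ?_⟩
    have : ∀ x, distBd Ω x = 0 := fun x => by simp [distBd, hE]
    have h0 : ∀ x, distBd Ω x ^ (-(s * p + α + β)) = 0 := fun x => by
      rw [this x, Real.zero_rpow (neg_ne_zero.2 hγ0.ne')]
    simp only [h0, mul_zero, ENNReal.ofReal_zero, lintegral_zero]
    exact zero_le
  rcases hcase with ⟨hγ, hb, rfl⟩ | ⟨hγ, hb, rfl⟩ | ⟨hγ, hb, rfl⟩
  · obtain ⟨c, M, hc, hM, h⟩ :=
      hardy_of_lt_lowerCodimA hopen hE hκ0 hκ1 hplump hs0 hp hα0 hβ0 hγ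
    refine ⟨c, 2 * M, hc, by linarith, fun u hu hfin => (h u hu hfin).trans (le_of_eq ?_)⟩
    have hdiam : EMetric.diam Ω = ⊤ := by
      by_contra hne
      exact hb (Metric.isBounded_iff_ediam_ne_top.2 hne)
    simp [hdiam]
  · obtain ⟨c, M, hc, hM, h⟩ :=
      hardy_of_lt_lowerCodimA hopen hE hκ0 hκ1 hplump hs0 hp hα0 hβ0 hγ
    have hM0 : 0 < M := by linarith
    have hfin : EMetric.diam Ω ≠ ⊤ := Metric.isBounded_iff_ediam_ne_top.1 hb
    have hD0 : 0 < Metric.diam Ω := by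
      obtain ⟨x, hx⟩ := hne
      have hpos := distBd_pos hopen hE hx
      refine ENNReal.toReal_pos (ne_of_gt ?_) hfin
      exact (zero_le).trans_lt (ofReal_lt_ediam_of_lt_distBd hE hx hpos hpos)
    set k := (Metric.diam Ω / M) ^ (-(s * p + α + β)) with hk
    have hk0 : 0 < k := by positivity
    refine ⟨c + 2 * k, 2 * M, by positivity, by linarith, fun u hu hI => (h u hu hI).trans ?_⟩
    gcongr ?_ * _ + ?_
    · exact ENNReal.ofReal_le_ofReal (by linarith)
    rw [mul_one]
    calc 2 * ∫⁻ x in Ω \ {x ∈ Ω | ENNReal.ofReal (M * distBd Ω x) < EMetric.diam Ω},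
          ENNReal.ofReal (|u x| ^ p * distBd Ω x ^ (-(s * p + α + β)))
        ≤ 2 * ∫⁻ x in Ω \ {x ∈ Ω | ENNReal.ofReal (M * distBd Ω x) < EMetric.diam Ω},
          ENNReal.ofReal k * ENNReal.ofReal (|u x| ^ p) := by
          gcongr 2 * ?_
          have hm : MeasurableSet
              (Ω \ {x ∈ Ω | ENNReal.ofReal (M * distBd Ω x) < EMetric.diam Ω}) :=
            hopen.measurableSet.diff (hopen.measurableSet.inter
              ((isOpen_lt (ENNReal.continuous_ofReal.comp
                (continuous_const.mul (continuous_distBd Ω))) continuous_const).measurableSet))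
          refine setLIntegral_mono' hm fun x hx => ?_
          rw [← ENNReal.ofReal_mul hk0.le, mul_comm k]
          refine ENNReal.ofReal_le_ofReal (mul_le_mul_of_nonneg_left ?_ (by positivity))
          refine Real.rpow_le_rpow_of_nonpos (by positivity) ?_ (by linarith)
          rw [div_le_iff₀' hM0]
          have hpos := distBd_pos hopen hE hx.1
          have hle : EMetric.diam Ω ≤ ENNReal.ofReal (M * distBd Ω x) :=
            not_lt.1 fun hlt => hx.2 ⟨hx.1, hlt⟩
          exact ENNReal.toReal_le_of_le_ofReal (by positivity) hle
      _ ≤ 2 * ∫⁻ x in Ω, ENNReal.ofReal k * ENNReal.ofReal (|u x| ^ p) := by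
          gcongr
          exact sdiff_subset
      _ = ENNReal.ofReal (2 * k) * ∫⁻ x in Ω, ENNReal.ofReal (|u x| ^ p) := by
          rw [lintegral_const_mul' _ _ ENNReal.ofReal_ne_top, ENNReal.ofReal_mul zero_le_two,
            ENNReal.ofReal_ofNat, mul_assoc]
      _ ≤ _ := by
          gcongr
          linarith
  · obtain ⟨c, hc, h⟩ :=
      hardy_of_upperCodimA_lt hopen hE hκ0 hκ1 hplump hs0 hp hα0 hβ0 hγ hb
    refine ⟨c, 5, hc, by norm_num, fun u hu hfin => (h u hu hfin).trans (le_of_eq ?_)⟩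
    simp
end

section
/- Let Ω ⊂ ℝ^d be a nonempty, bounded, open set, let 0 < s < 1, 1 ≤ p < ∞ and let α, β ≥ 0 satisfy α + β < d − dim̄_M(∂Ω). Then C_c^∞(Ω) ⊂ W^{s,p;α,β}(Ω). -/
open MeasureTheory Metric Set Filter
open scoped ENNReal NNReal

/-- A negative power of a nonnegative function `g` is integrable over a finite measure space as
soon as the sublevel sets of `g` have polynomially small measure of a larger order. -/
theorem lintegral_rpow_neg_lt_top {X : Type*} [MeasurableSpace X] {μ : Measure X}
    [IsFiniteMeasure μ] {g : X → ℝ} (hg : Measurable g) (hg0 : ∀ x, 0 ≤ g x) {q a C ρ : ℝ}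
    (ha : 0 ≤ a) (haq : a < q) (hρ : 0 < ρ)
    (hμ : ∀ r, 0 < r → r ≤ ρ → μ {x | g x ≤ r} ≤ ENNReal.ofReal (C * r ^ q)) :
    ∫⁻ x, ENNReal.ofReal (g x ^ (-a)) ∂μ < ⊤ := by
  let r : ℕ → ℝ := fun n => ρ * (1 / 2) ^ n
  have hr : ∀ n, 0 < r n := fun n => by positivity
  have hrρ : ∀ n, r n ≤ ρ := fun n =>
    mul_le_of_le_one_right hρ.le (pow_le_one₀ (by norm_num) (by norm_num))
  have hmeas : ∀ n, MeasurableSet {x | g x ≤ r n} := fun n => measurableSet_le hg measurable_const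
  have hpt : ∀ x, ENNReal.ofReal (g x ^ (-a)) ≤ ENNReal.ofReal (ρ ^ (-a)) +
      ∑' n, {x | g x ≤ r n}.indicator (fun _ => ENNReal.ofReal (r (n + 1) ^ (-a))) x := by
    intro x
    rcases (hg0 x).eq_or_lt with h0 | h0
    · refine le_trans (ENNReal.ofReal_le_ofReal ?_) le_self_add
      rw [← h0]
      rcases ha.eq_or_lt with ha | ha
      · simp [← ha]
      · rw [Real.zero_rpow (by linarith)]
        positivity
    rcases le_total ρ (g x) with h1 | h1
    · exact le_trans (ENNReal.ofReal_le_ofReal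
        (Real.rpow_le_rpow_of_nonpos hρ h1 (by linarith))) le_self_add
    obtain ⟨n, hn, hn'⟩ := exists_nat_pow_near_of_lt_one (x := g x / ρ) (y := (1 / 2 : ℝ))
      (by positivity) ((div_le_one hρ).2 h1) (by norm_num) (by norm_num)
    rw [lt_div_iff₀ hρ, mul_comm] at hn
    rw [div_le_iff₀ hρ, mul_comm] at hn'
    refine le_trans ?_ (le_trans (ENNReal.le_tsum n) le_add_self)
    rw [Set.indicator_of_mem (by exact hn')]
    exact ENNReal.ofReal_le_ofReal (Real.rpow_le_rpow_of_nonpos (hr _) hn.le (by linarith))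
  refine (lintegral_mono hpt).trans_lt ?_
  rw [lintegral_add_left measurable_const, lintegral_const,
    lintegral_tsum fun n => (measurable_const.indicator (hmeas n)).aemeasurable]
  refine ENNReal.add_lt_top.2 ⟨ENNReal.mul_lt_top ENNReal.ofReal_lt_top (measure_lt_top _ _), ?_⟩
  have hterm : ∀ n, ∫⁻ x, {x | g x ≤ r n}.indicator
      (fun _ => ENNReal.ofReal (r (n + 1) ^ (-a))) x ∂μ ≤
      ENNReal.ofReal (C * ρ ^ q * (ρ / 2) ^ (-a) * ((1 / 2 : ℝ) ^ (q - a)) ^ n) := by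
    intro n
    rw [lintegral_indicator_const (hmeas n)]
    refine (mul_le_mul_right (hμ _ (hr n) (hrρ n)) _).trans ?_
    rw [← ENNReal.ofReal_mul (Real.rpow_nonneg (hr _).le _)]
    apply ENNReal.ofReal_le_ofReal (le_of_eq _)
    have h1 : r (n + 1) = ρ / 2 * (1 / 2) ^ n := by simp only [r]; ring
    have h2 : ((1 / 2 : ℝ) ^ n) ^ q * ((1 / 2 : ℝ) ^ n) ^ (-a) = ((1 / 2 : ℝ) ^ (q - a)) ^ n := by
      rw [← Real.rpow_add (by positivity), ← Real.rpow_natCast, ← Real.rpow_natCast,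
        ← Real.rpow_mul (by norm_num), ← Real.rpow_mul (by norm_num)]
      ring_nf
    rw [h1, Real.mul_rpow (by positivity) (by positivity),
      Real.mul_rpow (by positivity) (by positivity), ← h2]
    ring
  refine (ENNReal.tsum_le_tsum hterm).trans_lt (Summable.tsum_ofReal_lt_top ?_)
  exact (summable_geometric_of_lt_one (by positivity)
    (Real.rpow_lt_one (by norm_num) (by norm_num) (by linarith))).mul_left _

/-- The power `‖z‖ ^ a` is integrable on balls around the origin of `ℝ^d` when `-d < a`. -/
theorem setLIntegral_norm_rpow_lt_top {d : ℕ} {a : ℝ} (ha : -(d : ℝ) < a) (D : ℝ) :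
    ∫⁻ z in closedBall (0 : Rd d) D, ENNReal.ofReal (‖z‖ ^ a) < ⊤ := by
  have hfin : IsFiniteMeasure (volume.restrict (closedBall (0 : Rd d) D)) :=
    ⟨by simpa using measure_closedBall_lt_top⟩
  rcases le_total 0 a with h0 | h0
  · refine (setLIntegral_mono (g := fun _ => ENNReal.ofReal (D ^ a)) measurable_const
      fun z hz => ENNReal.ofReal_le_ofReal
        (Real.rpow_le_rpow (norm_nonneg z) (by simpa using hz) h0)).trans_lt ?_
    rw [lintegral_const]
    exact ENNReal.mul_lt_top ENNReal.ofReal_lt_top (measure_lt_top _ _)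
  · have := lintegral_rpow_neg_lt_top (μ := volume.restrict (closedBall (0 : Rd d) D))
      (g := fun z => ‖z‖) measurable_norm (fun z => norm_nonneg z) (q := d) (a := -a)
      (C := (volume (ball (0 : Rd d) 1)).toReal) (ρ := 1) (by linarith) (by linarith)
      one_pos ?_
    · simpa using this
    · intro r hr _
      refine (Measure.restrict_apply_le _ _).trans ?_
      have : {z : Rd d | ‖z‖ ≤ r} = closedBall 0 r := by ext; simp
      rw [this, Measure.addHaar_closedBall _ _ hr.le, mul_comm,
        ENNReal.ofReal_mul ENNReal.toReal_nonneg, ENNReal.ofReal_toReal measure_ball_lt_top.ne]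
      simp

/-- Uniform bound for the integrals of the kernel `dist x y ^ a` over a bounded set. -/
theorem setLIntegral_dist_rpow_le {d : ℕ} {Ω : Set (Rd d)} {D : ℝ} (hΩ : MeasurableSet Ω)
    (hD : ∀ x ∈ Ω, ∀ y ∈ Ω, dist x y ≤ D) (a : ℝ) {x : Rd d} (hx : x ∈ Ω) :
    ∫⁻ y in Ω, ENNReal.ofReal (dist x y ^ a) ≤
      ∫⁻ z in closedBall (0 : Rd d) D, ENNReal.ofReal (‖z‖ ^ a) := by
  rw [← lintegral_indicator hΩ, ← lintegral_indicator measurableSet_closedBall,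
    ← lintegral_sub_left_eq_self ((closedBall (0 : Rd d) D).indicator _) x]
  refine lintegral_mono fun y => ?_
  by_cases hy : y ∈ Ω
  · have : x - y ∈ closedBall (0 : Rd d) D := by
      simpa [dist_eq_norm] using hD x hx y hy
    rw [indicator_of_mem hy, indicator_of_mem this, dist_eq_norm]
  · simp [hy]

/-- If `q < d - dim_M(E)` for a bounded set `E`, then small neighbourhoods of radius `r` of `E`
have volume at most `r ^ q'` for some `q' > q`. -/
theorem exists_volume_cthickening_le_s11 {d : ℕ} {E : Set (Rd d)} (hE : Bornology.IsBounded E) {q : ℝ}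
    (hq : q < (d : ℝ) - upperMinkDim E) :
    ∃ q' > q, ∃ ρ > 0, ∀ r, 0 < r → r ≤ ρ →
      volume (cthickening r E) ≤ ENNReal.ofReal (r ^ q') := by
  have hne : {t : ℝ | 0 ≤ t ∧ limsup (fun r : ℝ =>
      volume (cthickening r E) * ENNReal.ofReal (r ^ (t - (d : ℝ))))
      (nhdsWithin 0 (Ioi 0)) = 0}.Nonempty := by
    refine ⟨d + 1, by positivity, Tendsto.limsup_eq ?_⟩
    have hlim : Tendsto (fun r : ℝ => volume (cthickening 1 E) * ENNReal.ofReal r)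
        (nhdsWithin 0 (Ioi 0)) (nhds 0) := by
      have h1 : Tendsto (fun r : ℝ => ENNReal.ofReal r) (nhdsWithin 0 (Ioi 0)) (nhds 0) := by
        simpa using (ENNReal.continuous_ofReal.tendsto 0).mono_left nhdsWithin_le_nhds
      simpa using ENNReal.Tendsto.const_mul h1
        (Or.inr (hE.cthickening (δ := 1)).measure_lt_top.ne)
    refine tendsto_of_tendsto_of_tendsto_of_le_of_le' tendsto_const_nhds hlim
      (Eventually.of_forall fun _ => zero_le) ?_
    filter_upwards [Ioo_mem_nhdsGT (zero_lt_one (α := ℝ))] with r hr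
    simp only [add_sub_cancel_left, Real.rpow_one]
    gcongr
    exact cthickening_mono hr.2.le _
  obtain ⟨t, ⟨_, ht⟩, htq⟩ := exists_lt_of_csInf_lt (b := d - q) hne
    (by change upperMinkDim E < _; linarith)
  refine ⟨d - t, by linarith, ?_⟩
  have hev := eventually_lt_of_limsup_lt (ht.trans_lt zero_lt_one)
  obtain ⟨ρ, hρ, hρ'⟩ := (mem_nhdsGT_iff_exists_Ioc_subset).1 hev
  refine ⟨ρ, hρ, fun r hr hrρ => ?_⟩
  have h1 : volume (cthickening r E) * ENNReal.ofReal (r ^ (t - (d : ℝ))) < 1 := hρ' ⟨hr, hrρ⟩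
  have h2 : ENNReal.ofReal (r ^ (t - (d : ℝ))) * ENNReal.ofReal (r ^ ((d : ℝ) - t)) = 1 := by
    rw [← ENNReal.ofReal_mul (by positivity), ← Real.rpow_add hr]
    simp
  calc volume (cthickening r E)
      = volume (cthickening r E) * ENNReal.ofReal (r ^ (t - (d : ℝ))) *
          ENNReal.ofReal (r ^ ((d : ℝ) - t)) := by rw [mul_assoc, h2, mul_one]
    _ ≤ 1 * ENNReal.ofReal (r ^ ((d : ℝ) - t)) := by gcongr
    _ = _ := one_mul _

/-- Powers of the distance to the boundary are integrable below the Minkowski codimension. -/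
theorem setLIntegral_distBd_rpow_neg_lt_top {d : ℕ} {Ω : Set (Rd d)}
    (hbdd : Bornology.IsBounded Ω) (hfr : (frontier Ω).Nonempty) {a : ℝ} (ha : 0 ≤ a)
    (h : a < (d : ℝ) - upperMinkDim (frontier Ω)) :
    ∫⁻ x in Ω, ENNReal.ofReal (distBd Ω x ^ (-a)) < ⊤ := by
  have hfin : IsFiniteMeasure (volume.restrict Ω) := ⟨by simpa using hbdd.measure_lt_top⟩
  obtain ⟨q, hq, ρ, hρ, hvol⟩ := exists_volume_cthickening_le_s11
    (hbdd.closure.subset frontier_subset_closure) h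
  refine lintegral_rpow_neg_lt_top (C := 1) (continuous_infDist_pt _).measurable
    (fun x => infDist_nonneg) ha hq hρ fun r hr hrρ => ?_
  rw [one_mul]
  refine (Measure.restrict_apply_le _ _).trans ((measure_mono fun x hx => ?_).trans
    (hvol r hr hrρ))
  rw [mem_cthickening_iff, ← ENNReal.ofReal_toReal (infEDist_ne_top hfr)]
  exact ENNReal.ofReal_le_ofReal hx

/-- Pointwise bound of the weighted Gagliardo integrand of a compactly supported Lipschitz
function by the sum of a locally integrable kernel and a product of weights. -/
theorem exists_gagliardo_integrand_le {d : ℕ} {Ω : Set (Rd d)} (hopen : IsOpen Ω)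
    (hfr : (frontier Ω).Nonempty) {s p α β : ℝ} (hs0 : 0 < s) (hp : 1 ≤ p)
    (hα : 0 ≤ α) (hβ : 0 ≤ β) {φ : Rd d → ℝ} {L : ℝ≥0} (hL : LipschitzWith L φ)
    (hφ : HasCompactSupport φ) (hsupp : tsupport φ ⊆ Ω) :
    ∃ A B : ℝ, 0 ≤ A ∧ 0 ≤ B ∧ ∀ x y,
      |φ x - φ y| ^ p / dist x y ^ ((d : ℝ) + s * p) * distBd Ω y ^ (-β) * distBd Ω x ^ (-α) ≤
        A * dist x y ^ (p - (d + s * p)) + B * distBd Ω x ^ (-α) * distBd Ω y ^ (-β) := by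
  obtain ⟨η, hη, hthick⟩ := IsCompact.exists_thickening_subset_open hφ hopen hsupp
  obtain ⟨M, hM⟩ := hφ.exists_bound_of_continuous hL.continuous
  have hM0 : 0 ≤ M := (norm_nonneg _).trans (hM 0)
  have hnn : ∀ x, 0 ≤ distBd Ω x := fun x => infDist_nonneg
  have hzero : ∀ x, distBd Ω x < η → φ x = 0 := by
    intro x hx
    by_contra hne
    obtain ⟨z, hz, hxz⟩ := (infDist_lt_iff hfr).1 hx
    refine (hopen.inter_frontier_eq ▸ (⟨hthick ?_, hz⟩ : z ∈ Ω ∩ frontier Ω) : z ∈ (∅ : Set _))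
    exact mem_thickening_iff.2 ⟨x, subset_tsupport _ hne, by rwa [dist_comm]⟩
  have hlip : ∀ x y, distBd Ω x ≤ distBd Ω y + dist x y := fun x y => infDist_le_infDist_add_dist
  have hE : 0 ≤ (d : ℝ) + s * p := by positivity
  set δ := η / 2 with hδ
  have hδ0 : 0 < δ := by positivity
  refine ⟨(L : ℝ) ^ p * δ ^ (-β) * δ ^ (-α), (2 * M) ^ p / δ ^ ((d : ℝ) + s * p),
    by positivity, by positivity, fun x y => ?_⟩
  have hx := hnn x
  have hy := hnn y
  have htriv : φ x - φ y = 0 →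
      |φ x - φ y| ^ p / dist x y ^ ((d : ℝ) + s * p) * distBd Ω y ^ (-β) * distBd Ω x ^ (-α) ≤
      (L : ℝ) ^ p * δ ^ (-β) * δ ^ (-α) * dist x y ^ (p - (d + s * p)) +
      (2 * M) ^ p / δ ^ ((d : ℝ) + s * p) * distBd Ω x ^ (-α) * distBd Ω y ^ (-β) := by
    intro h0
    rw [h0, abs_zero, Real.zero_rpow (by linarith), zero_div, zero_mul, zero_mul]
    positivity
  by_cases hfar : δ ≤ dist x y
  · have h1 : |φ x - φ y| ≤ 2 * M := by
      have h2 := abs_sub (φ x) (φ y)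
      have := hM x
      have := hM y
      simp only [Real.norm_eq_abs] at *
      linarith
    have h2 : |φ x - φ y| ^ p / dist x y ^ ((d : ℝ) + s * p) ≤
        (2 * M) ^ p / δ ^ ((d : ℝ) + s * p) := by gcongr
    have h3 : |φ x - φ y| ^ p / dist x y ^ ((d : ℝ) + s * p) * (distBd Ω y ^ (-β) *
        distBd Ω x ^ (-α)) ≤ (2 * M) ^ p / δ ^ ((d : ℝ) + s * p) *
        (distBd Ω y ^ (-β) * distBd Ω x ^ (-α)) := by gcongr
    have h4 : 0 ≤ (L : ℝ) ^ p * δ ^ (-β) * δ ^ (-α) * dist x y ^ (p - (d + s * p)) := by positivity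
    linarith
  push Not at hfar
  by_cases hin : δ ≤ distBd Ω x ∧ δ ≤ distBd Ω y
  · rcases eq_or_ne x y with rfl | hxy
    · exact htriv (sub_self _)
    have hd : 0 < dist x y := dist_pos.2 hxy
    have h1 : |φ x - φ y| ^ p / dist x y ^ ((d : ℝ) + s * p) ≤
        (L : ℝ) ^ p * dist x y ^ (p - (d + s * p)) := by
      rw [Real.rpow_sub hd, ← mul_div_assoc, ← Real.mul_rpow (by positivity) hd.le]
      gcongr
      exact hL.dist_le_mul x y
    have h2 : distBd Ω y ^ (-β) ≤ δ ^ (-β) :=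
      Real.rpow_le_rpow_of_nonpos hδ0 hin.2 (by linarith)
    have h3 : distBd Ω x ^ (-α) ≤ δ ^ (-α) :=
      Real.rpow_le_rpow_of_nonpos hδ0 hin.1 (by linarith)
    calc _ ≤ (L : ℝ) ^ p * dist x y ^ (p - (d + s * p)) * δ ^ (-β) * δ ^ (-α) := by gcongr
      _ = (L : ℝ) ^ p * δ ^ (-β) * δ ^ (-α) * dist x y ^ (p - (d + s * p)) := by ring
      _ ≤ _ := le_add_of_nonneg_right (by positivity)
  · have h1 := hlip x y
    have h2 := hlip y x
    rw [dist_comm] at h2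
    have h3 : distBd Ω x < η ∧ distBd Ω y < η := by
      rcases not_and_or.1 hin with h | h <;> constructor <;> linarith
    exact htriv (by rw [hzero x h3.1, hzero y h3.2, sub_self])

/-- for a nonempty bounded open set, if `α + β < d - dim_M(∂Ω)` then
`C_c^∞(Ω) ⊂ W^{s,p;α,β}(Ω)`. -/
theorem stmt11 {d : ℕ} (Ω : Set (Rd d)) (hne : Ω.Nonempty)
    (hopen : IsOpen Ω) (hbdd : Bornology.IsBounded Ω) (s p α β : ℝ)
    (hs0 : 0 < s) (hs1 : s < 1) (hp : 1 ≤ p) (hα0 : 0 ≤ α) (hβ0 : 0 ≤ β)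
    (h : α + β < (d : ℝ) - upperMinkDim (frontier Ω)) :
    ∀ φ : Rd d → ℝ, ContDiff ℝ (⊤ : ℕ∞) φ → HasCompactSupport φ → tsupport φ ⊆ Ω →
      memW Ω s p α β φ := by
  intro φ hφ hφc hsupp
  refine ⟨(hφ.continuous.memLp_of_hasCompactSupport hφc).restrict _, ?_⟩
  have hdim : 0 ≤ upperMinkDim (frontier Ω) := Real.sInf_nonneg fun t ht => ht.1
  have hd : 0 < d := by
    have : (0 : ℝ) < d := by linarith
    exact_mod_cast this
  have : Nonempty (Fin d) := ⟨⟨0, hd⟩⟩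
  have hfr : (frontier Ω).Nonempty := by
    refine nonempty_frontier_iff.2 ⟨hne, ?_⟩
    rintro rfl
    exact NormedSpace.unbounded_univ ℝ (Rd d) hbdd
  obtain ⟨L, hL⟩ := ContDiff.lipschitzWith_of_hasCompactSupport hφc hφ (by simp)
  obtain ⟨A, B, hA, hB, hAB⟩ := exists_gagliardo_integrand_le hopen hfr hs0 hp hα0 hβ0 hL hφc hsupp
  obtain ⟨D, hD⟩ := isBounded_iff.1 hbdd
  have hα := setLIntegral_distBd_rpow_neg_lt_top hbdd hfr hα0 (by linarith)
  have hβ := setLIntegral_distBd_rpow_neg_lt_top hbdd hfr hβ0 (by linarith)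
  set e := p - ((d : ℝ) + s * p) with he
  have hker := setLIntegral_norm_rpow_lt_top (d := d) (a := e) (by nlinarith) D
  set K := ∫⁻ z in closedBall (0 : Rd d) D, ENNReal.ofReal (‖z‖ ^ e) with hK
  set Iα := ∫⁻ x in Ω, ENNReal.ofReal (distBd Ω x ^ (-α)) with hIα
  set Iβ := ∫⁻ x in Ω, ENNReal.ofReal (distBd Ω x ^ (-β)) with hIβ
  have hmeas : Measurable (distBd Ω) := (continuous_infDist_pt _).measurable
  have hnn : ∀ x, 0 ≤ distBd Ω x := fun x => infDist_nonneg
  have hinner : ∀ x ∈ Ω, ∫⁻ y in Ω, ENNReal.ofReal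
      (|φ x - φ y| ^ p / dist x y ^ ((d : ℝ) + s * p) * distBd Ω y ^ (-β) * distBd Ω x ^ (-α)) ≤
      ENNReal.ofReal A * K + ENNReal.ofReal B * Iβ * ENNReal.ofReal (distBd Ω x ^ (-α)) := by
    intro x hx
    have hw : 0 ≤ distBd Ω x ^ (-α) := Real.rpow_nonneg (hnn x) _
    calc _ ≤ ∫⁻ y in Ω, (ENNReal.ofReal A * ENNReal.ofReal (dist x y ^ e) +
          ENNReal.ofReal (B * distBd Ω x ^ (-α)) * ENNReal.ofReal (distBd Ω y ^ (-β))) := by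
          refine lintegral_mono fun y => ?_
          rw [← ENNReal.ofReal_mul hA, ← ENNReal.ofReal_mul (by positivity),
            ← ENNReal.ofReal_add (by positivity)
              (mul_nonneg (by positivity) (Real.rpow_nonneg (hnn y) _))]
          exact ENNReal.ofReal_le_ofReal (hAB x y)
      _ = ENNReal.ofReal A * (∫⁻ y in Ω, ENNReal.ofReal (dist x y ^ e)) +
          ENNReal.ofReal (B * distBd Ω x ^ (-α)) * Iβ := by
          rw [lintegral_add_left (by fun_prop), lintegral_const_mul _ (by fun_prop),
            lintegral_const_mul _ (by fun_prop)]
      _ ≤ _ := by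
          rw [ENNReal.ofReal_mul hB, mul_right_comm]
          gcongr
          exact setLIntegral_dist_rpow_le hopen.measurableSet
            (fun x hx y hy => hD hx hy) e hx
  refine (setLIntegral_mono (by fun_prop) hinner).trans_lt ?_
  rw [lintegral_add_left measurable_const, lintegral_const, Measure.restrict_apply_univ,
    lintegral_const_mul _ (by fun_prop)]
  exact ENNReal.add_lt_top.2 ⟨ENNReal.mul_lt_top (ENNReal.mul_lt_top ENNReal.ofReal_lt_top hker)
    hbdd.measure_lt_top, ENNReal.mul_lt_top (ENNReal.mul_lt_top ENNReal.ofReal_lt_top hβ) hα⟩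
end
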